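/- Let k ≥ 2, n = k(k+1)/2, and let α be an n-tuple of pairwise independent irrational numbers with k(α) = k. Then there exists T > 1 such that for every t_0 ≥ T, the sequence {v_α(t_i)}_{i≥0} of order vectors at the moments of permutation changes is periodic with period k: v_α(t_{i+sk}) = v_α(t_i) for all 0 ≤ i ≤ k−1 and all s ≥ 0, and the k values v_α(t_0), v_α(t_1), …, v_α(t_{k−1}) are pairwise distinct. -/

import Mathlib

/-- Distance from `x` to the nearest integer. -/
noncomputable def distToInt (x : ℝ) : ℝ := |x - round x|

/-- The irrationality measure function `ψ_α(t) = min_{1 ≤ q ≤ t} ‖qα‖`. -/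
noncomputable def psi (α : ℝ) (t : ℝ) : ℝ :=
  sInf ((fun q : ℤ => distToInt ((q : ℝ) * α)) '' {q : ℤ | 1 ≤ q ∧ (q : ℝ) ≤ t})

/-- An `n`-tuple is pairwise independent if eventually all the values
`ψ_{α_i}(t)` are pairwise distinct. -/
def PairwiseIndependent {n : ℕ} (α : Fin n → ℝ) : Prop :=
  ∃ T : ℝ, 0 ≤ T ∧ ∀ t : ℝ, T ≤ t → ∀ i j : Fin n, i ≠ j → psi (α i) t ≠ psi (α j) t

/-- `v : Fin n → Fin n` is the order vector of `α` at time `t`: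
`ψ_{α_{v 0}}(t) > ψ_{α_{v 1}}(t) > … > ψ_{α_{v (n-1)}}(t)`. -/
def IsOrderVec {n : ℕ} (α : Fin n → ℝ) (t : ℝ) (v : Fin n → Fin n) : Prop :=
  Function.Bijective v ∧
    ∀ p q : Fin n, p < q → psi (α (v p)) t > psi (α (v q)) t

/-- The order vector `v` occurs at arbitrarily large times. -/
def OccursInfinitely {n : ℕ} (α : Fin n → ℝ) (v : Fin n → Fin n) : Prop :=
  ∀ T : ℝ, ∃ t : ℝ, T < t ∧ IsOrderVec α t v

/-- `k(α)`: the number of distinct order vectors occurring for arbitrarily large `t`. -/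
noncomputable def kAlpha {n : ℕ} (α : Fin n → ℝ) : ℕ :=
  Nat.card {v : Fin n → Fin n | OccursInfinitely α v}

/-- The relative order of the functions `ψ_{α_i}` is the same at times `t` and `t'`
(i.e. the order vectors coincide). -/
def SameOrder {n : ℕ} (α : Fin n → ℝ) (t t' : ℝ) : Prop :=
  ∀ i j : Fin n, (psi (α i) t < psi (α j) t ↔ psi (α i) t' < psi (α j) t')

/-- `ts` is a sequence of moments of permutation changes:
`ts (i+1) = min { t > ts i : v_α(t) ≠ v_α(ts i) }`. -/
def IsChangeSeq {n : ℕ} (α : Fin n → ℝ) (ts : ℕ → ℝ) : Prop :=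
  ∀ i : ℕ, IsLeast {t : ℝ | ts i < t ∧ ¬ SameOrder α (ts i) t} (ts (i + 1))

/-- The set of positions `(j,l)`, `1 ≤ j ≤ l ≤ k` (here `0`-based). -/
def PairIdx (k : ℕ) := {p : Fin k × Fin k // p.1 ≤ p.2}

/-- Construct a position from `0`-based indices `j ≤ l < k`. -/
def mkPos {k : ℕ} (j l : ℕ) (hj : j ≤ l) (hl : l < k) : PairIdx k :=
  ⟨(⟨j, lt_of_le_of_lt hj hl⟩, ⟨l, hl⟩), Fin.mk_le_mk.mpr hj⟩

/-- The position permutation underlying `π`: one has `π(u) = u ∘ tau`.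
In `1`-based notation: `tau (i,i) = (i+1,i+1)` for `i < k`, `tau (k,k) = (1,1)`,
`tau (i,k) = (1,i+1)` for `i < k`, and `tau (i,j) = (i+1,j+1)` otherwise. -/
def tau {k : ℕ} (p : PairIdx k) : PairIdx k :=
  if h2 : p.1.2.val = k - 1 then
    if h1 : p.1.1.val = k - 1 then
      ⟨(⟨0, by have := p.1.2.isLt; omega⟩, ⟨0, by have := p.1.2.isLt; omega⟩), le_refl _⟩
    else
      ⟨(⟨0, by have := p.1.2.isLt; omega⟩,
        ⟨p.1.1.val + 1, by have := p.1.1.isLt; omega⟩),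
       Fin.mk_le_mk.mpr (by omega)⟩
  else
    ⟨(⟨p.1.1.val + 1, by have h := p.1.2.isLt; have h' : p.1.1.val ≤ p.1.2.val := p.2; omega⟩,
      ⟨p.1.2.val + 1, by have h := p.1.2.isLt; omega⟩),
     Fin.mk_le_mk.mpr (by have h' : p.1.1.val ≤ p.1.2.val := p.2; omega)⟩

/-- The action of `π` on vectors indexed by positions: `π(u) = u ∘ tau`. -/
def piMap {k : ℕ} {X : Type*} (u : PairIdx k → X) : PairIdx k → X :=
  fun p => u (tau p)

/-- The (`0`-based) linear position of the pair `(j,l)` in the special enumeration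
`u_{1,1}, u_{1,k}, u_{1,k-1}, …, u_{1,2}, u_{2,2}, u_{2,k}, …, u_{k,k}`. -/
def posIdx {k : ℕ} (p : PairIdx k) : ℕ :=
  (p.1.1.val * k - p.1.1.val * (p.1.1.val - 1) / 2) +
    (if p.1.2.val = p.1.1.val then 0 else k - p.1.2.val)

/-- `v : PairIdx k → Fin n` is the order vector of `α` at time `t`, written in the
special pair enumeration: the function at position `p` is larger than the one at
position `q` whenever `p` precedes `q` in the enumeration. -/
def IsOrderVecP {n k : ℕ} (α : Fin n → ℝ) (t : ℝ) (v : PairIdx k → Fin n) : Prop :=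
  Function.Bijective v ∧
    ∀ p q : PairIdx k, posIdx p < posIdx q → psi (α (v p)) t > psi (α (v q)) t

/-- Denominator `q_m` of the `m`-th convergent of the continued fraction of `α`. -/
noncomputable def cfDen (α : ℝ) (m : ℕ) : ℝ := (GenContFract.of α).dens m

/-- The orbit equivalence relation of the map `tau` on positions. -/
def orbitSetoid (k : ℕ) : Setoid (PairIdx k) where
  r p q := ∃ a b : ℕ, (fun x : PairIdx k => tau x)^[a] p = (fun x : PairIdx k => tau x)^[b] q
  iseqv := by
    constructor
    · exact fun p => ⟨0, 0, rfl⟩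
    · rintro p q ⟨a, b, h⟩; exact ⟨b, a, h.symm⟩
    · rintro p q r ⟨a, b, h1⟩ ⟨c, d, h2⟩
      refine ⟨c + a, b + d, ?_⟩
      rw [Function.iterate_add_apply, h1, ← Function.iterate_add_apply,
        Nat.add_comm c b, Function.iterate_add_apply, h2, ← Function.iterate_add_apply]

section Combinatorics

/-- The sequence `F` drops at time `q`. -/
def Jumps (F : ℕ → ℝ) (q : ℕ) : Prop := F q < F (q - 1)

/-- `y < q` are consecutive drop times of `F`. -/
def ConsecJumps (F : ℕ → ℝ) (y q : ℕ) : Prop :=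
  y < q ∧ Jumps F y ∧ Jumps F q ∧ ∀ z, y < z → z < q → ¬ Jumps F z

theorem eq_of_no_jump {F : ℕ → ℝ} {T a b : ℕ} (hF : AntitoneOn F (Set.Ici T)) (hT : T ≤ a)
    (hab : a ≤ b) (h : ∀ z, a < z → z ≤ b → ¬ Jumps F z) : F b = F a := by
  induction b, hab using Nat.le_induction with
  | base => rfl
  | succ m hm ih =>
    rw [← ih fun z h1 h2 => h z h1 (by omega)]
    refine le_antisymm (hF (Set.mem_Ici.2 (by omega)) (Set.mem_Ici.2 (by omega)) (by omega)) ?_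
    have := h (m + 1) (by omega) le_rfl
    simpa [Jumps] using this

theorem ConsecJumps.eq_of_mem {F : ℕ → ℝ} {T y q t : ℕ} (h : ConsecJumps F y q)
    (hF : AntitoneOn F (Set.Ici T)) (hT : T ≤ y) (h1 : y ≤ t) (h2 : t < q) : F t = F y :=
  eq_of_no_jump hF hT h1 fun z hz1 hz2 => h.2.2.2 z hz1 (by omega)

theorem exists_consecJumps {F : ℕ → ℝ} {z q : ℕ} (hzq : z < q) (hz : Jumps F z)
    (hq : Jumps F q) : ∃ y, z ≤ y ∧ ConsecJumps F y q := by
  classical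
  refine ⟨Nat.findGreatest (Jumps F) (q - 1), Nat.le_findGreatest (by omega) hz, ?_,
    Nat.findGreatest_spec (P := Jumps F) (by omega : z ≤ q - 1) hz, hq, ?_⟩
  · have := Nat.findGreatest_le (P := Jumps F) (q - 1)
    omega
  · intro w h1 h2
    exact Nat.findGreatest_is_greatest h1 (by omega)

theorem ConsecJumps.left_unique {F : ℕ → ℝ} {y y' q : ℕ} (h : ConsecJumps F y q)
    (h' : ConsecJumps F y' q) : y = y' := by
  rcases lt_trichotomy y y' with hlt | rfl | hlt
  · exact absurd h'.2.1 (h.2.2.2 _ hlt h'.1)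
  · rfl
  · exact absurd h.2.1 (h'.2.2.2 _ hlt h.1)

theorem lt_of_no_jump {F G : ℕ → ℝ} {T a b : ℕ} (hF : AntitoneOn F (Set.Ici T))
    (hG : AntitoneOn G (Set.Ici T)) (hT : T ≤ a) (hab : a ≤ b) (hlt : F a < G a)
    (h : ∀ z, a < z → z ≤ b → ¬ Jumps G z) : F b < G b := by
  rw [eq_of_no_jump hG hT hab h]
  exact (hF (Set.mem_Ici.2 hT) (Set.mem_Ici.2 (hT.trans hab)) hab).trans_lt hlt

/-- The properties of finitely many irrationality measure functions that determine the
behaviour of their order from time `T` on. -/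
structure OscillatingFamily {ι : Type*} (F : ι → ℕ → ℝ) (T : ℕ) : Prop where
  anti : ∀ i, AntitoneOn (F i) (Set.Ici T)
  ne : ∀ t, T ≤ t → ∀ i j, i ≠ j → F i t ≠ F j t
  exists_jump : ∀ i N, ∃ q, N < q ∧ Jumps (F i) q
  lt_before_prev : ∀ i j q y, T < y → Jumps (F i) q → ConsecJumps (F j) y q →
    F j (q - 1) < F i (q - 1) → F i (y - 1) < F j (y - 1)
  prev_ne : ∀ i j y q, T < y → i ≠ j → ConsecJumps (F i) y q → ¬ ConsecJumps (F j) y q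
  prev_lt_prev : ∀ i j x y q, T < x → T < y → ConsecJumps (F i) x q → ConsecJumps (F j) y q →
    F j (q - 1) < F i (q - 1) → F j q < F i q → x < y
  exists_lt : ∀ i j, i ≠ j → ∀ N, ∃ t, N ≤ t ∧ F i t < F j t

open Classical in
/-- The order relation of the functions with index in `S` at time `t`. -/
noncomputable def orderState {ι : Type*} (F : ι → ℕ → ℝ) (S : Finset ι) (t : ℕ) : Finset (ι × ι) :=
  (S ×ˢ S).filter fun p => F p.1 t < F p.2 t

open Classical in
/-- The orders of the functions with index in `S` which occur at arbitrarily large times. -/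
noncomputable def recurrentStates {ι : Type*} [Fintype ι] (F : ι → ℕ → ℝ) (S : Finset ι) :
    Finset (Finset (ι × ι)) :=
  Finset.univ.filter fun v => ∀ N, ∃ t, N ≤ t ∧ orderState F S t = v

theorem lt_iff_of_orderState_eq {ι : Type*} {F : ι → ℕ → ℝ} {S : Finset ι} {s t : ℕ}
    (h : orderState F S s = orderState F S t) {i j : ι} (hi : i ∈ S) (hj : j ∈ S) :
    F i s < F j s ↔ F i t < F j t := by
  have := congrArg ((i, j) ∈ ·) h
  simpa [orderState, hi, hj] using this

theorem eventually_mem_recurrentStates {ι : Type*} [Fintype ι] (F : ι → ℕ → ℝ) :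
    ∃ N, ∀ S t, N ≤ t → orderState F S t ∈ recurrentStates F S := by
  suffices h : ∀ᶠ t in Filter.atTop, ∀ S v, orderState F S t = v → v ∈ recurrentStates F S by
    obtain ⟨N, hN⟩ := Filter.eventually_atTop.1 h
    exact ⟨N, fun S t ht => hN t ht S _ rfl⟩
  refine Filter.eventually_all.2 fun S => Filter.eventually_all.2 fun v => ?_
  by_cases hv : v ∈ recurrentStates F S
  · exact Filter.Eventually.of_forall fun _ _ => hv
  · obtain ⟨N, hN⟩ : ∃ N, ∀ t, N ≤ t → orderState F S t ≠ v := by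
      simpa [recurrentStates] using hv
    exact Filter.eventually_atTop.2 ⟨N, fun t ht h => absurd h (hN t ht)⟩

/-- `N` and `M` are thresholds: from time `N` on only recurrent orders occur, and every function
jumps between `N` and `M`. -/
structure Settled {ι : Type*} [Fintype ι] (F : ι → ℕ → ℝ) (T N M : ℕ) : Prop
    extends OscillatingFamily F T where
  le : T ≤ N
  mem : ∀ S t, N ≤ t → orderState F S t ∈ recurrentStates F S
  jump : ∀ i, ∃ z, N < z ∧ z ≤ M ∧ Jumps (F i) z

theorem OscillatingFamily.exists_settled {ι : Type*} [Fintype ι] {F : ι → ℕ → ℝ} {T : ℕ}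
    (h : OscillatingFamily F T) : ∃ N M, Settled F T N M := by
  obtain ⟨N, hN⟩ := eventually_mem_recurrentStates F
  choose z hz hj using fun i => h.exists_jump i (max T N)
  refine ⟨max T N, Finset.univ.sup z, h, le_max_left _ _,
    fun S t ht => hN S t (le_of_max_le_right ht), fun i => ⟨z i, hz i, ?_, hj i⟩⟩
  exact Finset.le_sup (Finset.mem_univ i)

namespace Settled

variable {ι : Type*} [Fintype ι] {F : ι → ℕ → ℝ} {T N M : ℕ}

theorem prev (h : Settled F T N M) {q : ℕ} (hq : M < q) {l : ι} (hl : Jumps (F l) q) :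
    ∃ y, N < y ∧ ConsecJumps (F l) y q := by
  obtain ⟨z, hNz, hzM, hz⟩ := h.jump l
  obtain ⟨y, hzy, hy⟩ := exists_consecJumps (hzM.trans_lt hq) hz hl
  exact ⟨y, by omega, hy⟩

theorem lt_of_consecJumps (h : Settled F T N M) {q y : ℕ} {l b : ι} (hy : N < y)
    (hc : ConsecJumps (F l) y q) (hlt : F l (q - 1) < F b (q - 1)) {t : ℕ} (h1 : y ≤ t)
    (h2 : t < q) : F l t < F b t := by
  have hT := h.le
  have := hc.1
  calc F l t = F l y := hc.eq_of_mem (h.anti l) (by omega) h1 h2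
    _ = F l (q - 1) := (hc.eq_of_mem (h.anti l) (by omega) (by omega) (by omega)).symm
    _ < F b (q - 1) := hlt
    _ ≤ F b t := h.anti b (Set.mem_Ici.2 (by omega)) (Set.mem_Ici.2 (by omega)) (by omega)

/-- The function with the largest value among those with index in `S` jumping at `q`. -/
def IsTop (F : ι → ℕ → ℝ) (S : Finset ι) (q : ℕ) (b : ι) : Prop :=
  b ∈ S ∧ Jumps (F b) q ∧
    ∀ l ∈ S, Jumps (F l) q → l ≠ b → F l (q - 1) < F b (q - 1)

theorem exists_isTop (h : Settled F T N M) {S : Finset ι} {q : ℕ} (hq : N < q)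
    (hS : ∃ l ∈ S, Jumps (F l) q) : ∃ b, IsTop F S q b := by
  classical
  have hT := h.le
  obtain ⟨l, hl, hlq⟩ := hS
  obtain ⟨b, hb, hmax⟩ := (S.filter fun l => Jumps (F l) q).exists_max_image
    (fun l => F l (q - 1)) ⟨l, by simp [hl, hlq]⟩
  rw [Finset.mem_filter] at hb
  exact ⟨b, hb.1, hb.2, fun l hl hlq hne => lt_of_le_of_ne
    (hmax l (by simp [hl, hlq])) (h.ne _ (by omega) _ _ hne)⟩

/-- Times before `q` at which the indices jumping at `q` witness pairwise distinct orders. -/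
theorem exists_times (h : Settled F T N M) {S : Finset ι} {q : ℕ} (hNM : N ≤ M) (hq : M < q)
    {b : ι} (hb : IsTop F S q b) :
    ∃ a : ι → ℕ, a b = q - 1 ∧
      (∀ l ∈ S, Jumps (F l) q → l ≠ b → N ≤ a l ∧ ConsecJumps (F l) (a l + 1) q ∧
        F b (a l) < F l (a l)) ∧
      Set.InjOn (fun l => orderState F S (a l)) {l | l ∈ S ∧ Jumps (F l) q} ∧
      ∀ l ∈ S, Jumps (F l) q → orderState F S (a l) ∈ recurrentStates F S := by
  classical
  have hT := h.le
  have key : ∀ l, ∃ a : ℕ, (l = b → a = q - 1) ∧ (l ∈ S → Jumps (F l) q → l ≠ b → N ≤ a ∧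
      ConsecJumps (F l) (a + 1) q ∧ F b a < F l a) := by
    intro l
    by_cases hl : l = b
    · exact ⟨q - 1, fun _ => rfl, fun _ _ h => absurd hl h⟩
    by_cases hlS : l ∈ S ∧ Jumps (F l) q
    · obtain ⟨y, hNy, hy⟩ := h.prev hq hlS.2
      refine ⟨y - 1, fun h => absurd h hl, fun _ _ _ => ⟨by omega, ?_, ?_⟩⟩
      · rwa [Nat.sub_add_cancel (by omega)]
      · exact h.lt_before_prev b l q y (by omega) hb.2.1 hy (hb.2.2 l hlS.1 hlS.2 hl)
    · exact ⟨0, fun h => absurd h hl, fun h1 h2 => absurd ⟨h1, h2⟩ hlS⟩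
  choose a ha1 ha2 using key
  have hinj : ∀ l l', l ∈ S → Jumps (F l) q → l' ∈ S → Jumps (F l') q → l ≠ b → a l < a l' →
      a l' < q → orderState F S (a l) ≠ orderState F S (a l') := by
    intro l l' hl hlq hl' hlq' hlb hlt hltq heq
    obtain ⟨h1, h2, h3⟩ := ha2 l hl hlq hlb
    have h4 := h.lt_of_consecJumps (by omega) h2 (hb.2.2 l hl hlq hlb) hlt hltq
    exact lt_asymm h4 ((lt_iff_of_orderState_eq heq hb.1 hl).1 h3)
  have hlt : ∀ l, l ∈ S → Jumps (F l) q → l ≠ b → a l < q - 1 := by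
    intro l hl hlq hlb
    have := (ha2 l hl hlq hlb).2.1.1
    omega
  refine ⟨a, ha1 b rfl, fun l hl hlq hlb => ha2 l hl hlq hlb, ?_, ?_⟩
  · rintro l ⟨hl, hlq⟩ l' ⟨hl', hlq'⟩ heq
    by_contra hne
    by_cases hlb : l = b
    · subst hlb
      have h1 := hlt l' hl' hlq' (Ne.symm hne)
      exact hinj l' l hl' hlq' hl hlq (Ne.symm hne) (by rw [ha1 l rfl]; exact h1)
        (by rw [ha1 l rfl]; omega) heq.symm
    by_cases hlb' : l' = b
    · subst hlb'
      have h1 := hlt l hl hlq hne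
      exact hinj l l' hl hlq hl' hlq' hne (by rw [ha1 l' rfl]; exact h1)
        (by rw [ha1 l' rfl]; omega) heq
    have h1 := hlt l hl hlq hlb
    have h2 := hlt l' hl' hlq' hlb'
    rcases lt_trichotomy (a l) (a l') with hc | hc | hc
    · exact hinj l l' hl hlq hl' hlq' hlb hc (by omega) heq
    · obtain ⟨h3, h4, -⟩ := ha2 l hl hlq hlb
      have h5 := (ha2 l' hl' hlq' hlb').2.1
      rw [← hc] at h5
      exact h.prev_ne l l' _ q (by omega) hne h4 h5
    · exact hinj l' l hl' hlq' hl hlq hlb' hc (by omega) heq.symm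
  · intro l hl hlq
    apply h.mem
    by_cases hlb : l = b
    · rw [hlb, ha1 b rfl]; omega
    · exact (ha2 l hl hlq hlb).1

theorem threshold_le (h : Settled F T N M) (i : ι) : N ≤ M := by
  obtain ⟨z, h1, h2, -⟩ := h.jump i
  omega

open Classical in
theorem card_jumps_le (h : Settled F T N M) (S : Finset ι) {q : ℕ} (hq : M < q) :
    (S.filter fun l => Jumps (F l) q).card ≤ (recurrentStates F S).card := by
  by_cases hS : ∃ l ∈ S, Jumps (F l) q
  · have hNM := h.threshold_le hS.choose
    obtain ⟨b, hb⟩ := h.exists_isTop (by omega) hS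
    obtain ⟨a, -, -, h3, h4⟩ := h.exists_times hNM hq hb
    refine Finset.card_le_card_of_injOn (fun l => orderState F S (a l)) ?_ ?_
    · intro l hl
      simp only [Finset.coe_filter, Set.mem_ofPred_eq] at hl
      exact h4 l hl.1 hl.2
    · simpa using h3
  · push Not at hS
    rw [Finset.filter_eq_empty_iff.2 fun l hl => hS l hl]
    simp

theorem exists_order_change (h : Settled F T N M) {S : Finset ι} (hS : 1 < S.card) (K : ℕ) :
    ∃ q, K < q ∧ orderState F S (q - 1) ≠ orderState F S q := by
  obtain ⟨i, hi, j, hj, hij⟩ := Finset.one_lt_card.1 hS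
  by_contra! hc
  obtain ⟨s, hs, hs'⟩ := h.exists_lt i j hij K
  obtain ⟨t, ht, ht'⟩ := h.exists_lt j i hij.symm K
  have hconst : ∀ t, K ≤ t → orderState F S t = orderState F S K := by
    intro t ht
    induction t, ht using Nat.le_induction with
    | base => rfl
    | succ m hm ih => rw [← ih, ← hc (m + 1) (by omega)]; rfl
  have := (lt_iff_of_orderState_eq ((hconst s hs).trans (hconst t ht).symm) hi hj).1 hs'
  exact lt_asymm this ht'

theorem jumps_or_of_not_iff (h : Settled F T N M) {q : ℕ} (hq : N < q) {i j : ι}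
    (hi : ¬ Jumps (F i) q) (hj : ¬ Jumps (F j) q) : F i (q - 1) < F j (q - 1) ↔ F i q < F j q := by
  have hT := h.le
  have key : ∀ l, ¬ Jumps (F l) q → F l q = F l (q - 1) := fun l hl =>
    eq_of_no_jump (h.anti l) (by omega) (by omega) fun z h1 h2 => by
      rwa [show z = q by omega]
  rw [key i hi, key j hj]

open Classical in
theorem card_recurrentStates_lt (h : Settled F T N M) (S : Finset ι) {q : ℕ} (hq : N < q)
    (hne : orderState F S (q - 1) ≠ orderState F S q) :
    (recurrentStates F (S.filter fun l => ¬ Jumps (F l) q)).card <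
      (recurrentStates F S).card := by
  set S' := S.filter fun l => ¬ Jumps (F l) q with hS'
  have hsub : S' ⊆ S := Finset.filter_subset _ _
  let r : Finset (ι × ι) → Finset (ι × ι) := fun v => v.filter fun p => p.1 ∈ S' ∧ p.2 ∈ S'
  have hr : ∀ t, r (orderState F S t) = orderState F S' t := by
    intro t
    ext ⟨i, j⟩
    simp only [r, orderState, Finset.mem_filter, Finset.mem_product]
    constructor
    · rintro ⟨⟨-, h1⟩, h2⟩; exact ⟨h2, h1⟩
    · rintro ⟨h2, h1⟩; exact ⟨⟨⟨hsub h2.1, hsub h2.2⟩, h1⟩, h2⟩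
  have hrq : r (orderState F S (q - 1)) = r (orderState F S q) := by
    rw [hr, hr]
    ext ⟨i, j⟩
    simp only [orderState, Finset.mem_filter, Finset.mem_product]
    refine and_congr_right fun hij => ?_
    exact h.jumps_or_of_not_iff hq (Finset.mem_filter.1 hij.1).2 (Finset.mem_filter.1 hij.2).2
  have himg : recurrentStates F S' ⊆
      ((recurrentStates F S).erase (orderState F S q)).image r := by
    intro v hv
    obtain ⟨t, ht, rfl⟩ := (Finset.mem_filter.1 hv).2 N
    rw [Finset.mem_image]
    by_cases hc : orderState F S t = orderState F S q
    · refine ⟨orderState F S (q - 1), Finset.mem_erase.2 ⟨hne, h.mem S _ (by omega)⟩, ?_⟩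
      rw [hrq, ← hc, hr]
    · exact ⟨orderState F S t, Finset.mem_erase.2 ⟨hc, h.mem S t ht⟩, hr t⟩
  calc _ ≤ _ := Finset.card_le_card himg
    _ ≤ _ := Finset.card_image_le
    _ < _ := Finset.card_erase_lt_of_mem (h.mem S q hq.le)

/-- `n` functions realise at least `k` orders infinitely often, where `n ≤ k (k + 1) / 2`. -/
theorem two_mul_card_le (h : Settled F T N M) (S : Finset ι) :
    2 * S.card ≤ (recurrentStates F S).card * ((recurrentStates F S).card + 1) := by
  classical
  induction S using Finset.strongInduction with
  | H S ih =>
    have hpos : 0 < (recurrentStates F S).card := Finset.card_pos.2 ⟨_, h.mem S N le_rfl⟩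
    by_cases hS : 1 < S.card
    · obtain ⟨q, hq, hne⟩ := h.exists_order_change hS M
      have hNM := h.threshold_le (Finset.card_pos.1 (by omega : 0 < S.card)).choose
      have h1 := h.card_jumps_le S hq
      have h2 := h.card_recurrentStates_lt S (by omega) hne
      have h3 := Finset.card_filter_add_card_filter_not (s := S) (fun l => Jumps (F l) q)
      have hss : S.filter (fun l => ¬ Jumps (F l) q) ⊂ S := by
        refine (Finset.filter_subset _ _).ssubset_of_ne fun heq => ?_
        rw [heq] at h2
        exact lt_irrefl _ h2
      have h4 := ih _ hss
      nlinarith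
    · nlinarith

theorem jumps_of_swap (h : Settled F T N M) {q : ℕ} (hq : N < q) {i j : ι}
    (h1 : F i (q - 1) < F j (q - 1)) (h2 : F j q < F i q) : Jumps (F j) q := by
  have hT := h.le
  by_contra hj
  refine lt_asymm h2 (lt_of_no_jump (h.anti i) (h.anti j) (a := q - 1) (by omega) (by omega) h1 ?_)
  intro z hz1 hz2
  rwa [show z = q by omega]

open Classical in
theorem card_jumps_eq (h : Settled F T N M) {c : ℕ} (hc : (recurrentStates F Finset.univ).card = c)
    (hι : c * (c + 1) ≤ 2 * Fintype.card ι) {q : ℕ} (hq : M < q) (hNM : N ≤ M)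
    (hne : orderState F Finset.univ (q - 1) ≠ orderState F Finset.univ q) :
    (Finset.univ.filter fun l => Jumps (F l) q).card = c := by
  have h1 := h.card_jumps_le Finset.univ hq
  have h2 := h.card_recurrentStates_lt Finset.univ (by omega) hne
  have h3 := Finset.card_filter_add_card_filter_not (s := Finset.univ) (fun l => Jumps (F l) q)
  have h4 := h.two_mul_card_le (Finset.univ.filter fun l => ¬ Jumps (F l) q)
  rw [Finset.card_univ] at h3
  rw [hc] at h1 h2
  refine le_antisymm h1 (not_lt.1 fun h5 => ?_)
  obtain ⟨d, rfl⟩ : ∃ d, c = d + 1 := ⟨c - 1, by omega⟩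
  have h6 := Nat.mul_le_mul (Nat.le_of_lt_succ h2) (h2 : _ + 1 ≤ d + 1)
  nlinarith

/-- If the number of functions is maximal, then every order other than the one just before a change
at `q` was last left at a jump of a function which jumps at `q` again. -/
theorem exists_exit (h : Settled F T N M) {c : ℕ}
    (hc : (recurrentStates F Finset.univ).card = c) (hι : c * (c + 1) ≤ 2 * Fintype.card ι) {q : ℕ}
    (hq : M < q) (hne : orderState F Finset.univ (q - 1) ≠ orderState F Finset.univ q) {b : ι}
    (hb : IsTop F Finset.univ q b) (u : Finset (ι × ι)) (hu : u ∈ recurrentStates F Finset.univ)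
    (hub : u ≠ orderState F Finset.univ (q - 1)) :
    ∃ l y, l ≠ b ∧ N < y ∧ ConsecJumps (F l) y q ∧ orderState F Finset.univ (y - 1) = u ∧
      F b (y - 1) < F l (y - 1) := by
  classical
  have hNM := h.threshold_le b
  obtain ⟨a, ha, h2, h3, h4⟩ := h.exists_times hNM hq hb
  have hcard := h.card_jumps_eq hc hι hq hNM hne
  have hsurj := Finset.surjOn_of_injOn_of_card_le (s := Finset.univ.filter fun l => Jumps (F l) q)
    (t := recurrentStates F Finset.univ) (fun l => orderState F Finset.univ (a l))
    (fun l hl => h4 l (Finset.mem_univ l) (by simpa using hl)) (by simpa using h3)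
    (by rw [hcard, hc])
  obtain ⟨l, hl, rfl⟩ := hsurj hu
  have hl : Jumps (F l) q := by simpa using hl
  have hlb : l ≠ b := by
    rintro rfl
    exact hub (by simp only [ha])
  obtain ⟨h5, h6, h7⟩ := h2 l (Finset.mem_univ l) hl hlb
  exact ⟨l, a l + 1, hlb, by omega, h6, rfl, h7⟩

theorem exists_next_change (h : Settled F T N M) {S : Finset ι} (hS : 1 < S.card) (q : ℕ) :
    ∃ q', q < q' ∧ orderState F S (q' - 1) ≠ orderState F S q' ∧
      ∀ t, q ≤ t → t < q' → orderState F S t = orderState F S q := by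
  classical
  have hex := h.exists_order_change hS q
  refine ⟨Nat.find hex, (Nat.find_spec hex).1, (Nat.find_spec hex).2, fun t ht => ?_⟩
  induction t, ht using Nat.le_induction with
  | base => exact fun _ => rfl
  | succ m hm ih =>
    intro hlt
    rw [← ih (by omega)]
    have := Nat.find_min hex hlt
    by_contra hne
    exact this ⟨by omega, fun heq => hne heq.symm⟩

/-- If the number of functions is maximal, then an order returns only after all the others have
been visited. -/
theorem exists_visit (h : Settled F T N M) {c : ℕ}
    (hc : (recurrentStates F Finset.univ).card = c) (hι : c * (c + 1) ≤ 2 * Fintype.card ι)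
    (hι1 : 1 < Fintype.card ι) {q s : ℕ} (hq : M < q)
    (hne : orderState F Finset.univ (q - 1) ≠ orderState F Finset.univ q) (hsq : s < q)
    (hs : orderState F Finset.univ s = orderState F Finset.univ q) (u₀ : Finset (ι × ι))
    (hu₀ : u₀ ∈ recurrentStates F Finset.univ) :
    ∃ t, s ≤ t ∧ t < q ∧ orderState F Finset.univ t = u₀ := by
  classical
  by_contra! hcon
  have hT := h.le
  have hNM := h.threshold_le (Fintype.card_pos_iff.1 (by omega : 0 < Fintype.card ι)).some
  have hjumps : ∀ {q}, M < q → orderState F Finset.univ (q - 1) ≠ orderState F Finset.univ q →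
      ∃ b, IsTop F Finset.univ q b := by
    intro q hq hne
    refine h.exists_isTop (by omega) ?_
    by_contra! hno
    refine hne ?_
    ext ⟨i, j⟩
    simpa [orderState] using h.jumps_or_of_not_iff (by omega) (hno i (Finset.mem_univ i))
      (hno j (Finset.mem_univ j))
  have hiff : ∀ {s t i j}, orderState F Finset.univ s = orderState F Finset.univ t →
      F i s < F j s → F i t < F j t := fun heq hlt =>
    (lt_iff_of_orderState_eq heq (Finset.mem_univ _) (Finset.mem_univ _)).1 hlt
  obtain ⟨q', hqq', hne', hconst⟩ := h.exists_next_change (S := Finset.univ)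
    (by rwa [Finset.card_univ]) q
  set σ := orderState F Finset.univ with hσ
  set V := recurrentStates F Finset.univ with hV
  have hmem : ∀ t, N ≤ t → σ t ∈ V := fun t ht => h.mem _ t ht
  have hwq' : σ (q' - 1) = σ q := hconst _ (by omega) (by omega)
  obtain ⟨β, hβ⟩ := hjumps hq hne
  obtain ⟨β', hβ'⟩ := hjumps (hq.trans hqq') hne'
  have : Nonempty ι := ⟨β⟩
  have hexit : ∀ u ∈ V, u ≠ σ (q - 1) → ∃ l y, l ≠ β ∧ N < y ∧ ConsecJumps (F l) y q ∧
      σ (y - 1) = u ∧ F β (y - 1) < F l (y - 1) := h.exists_exit hc hι hq hne hβ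
  have hexit' : ∀ u ∈ V, u ≠ σ (q' - 1) → ∃ l y, l ≠ β' ∧ N < y ∧ ConsecJumps (F l) y q' ∧
      σ (y - 1) = u ∧ F β' (y - 1) < F l (y - 1) := h.exists_exit hc hι (hq.trans hqq') hne' hβ'
  rw [hwq'] at hexit'
  choose! l e hlb hNe hce hse hFe using hexit
  choose! l' e' hlb' hNe' hce' hse' hFe' using hexit'
  have hlt : ∀ u ∈ V, u ≠ σ (q - 1) → ∀ t, e u ≤ t → t < q → F (l u) t < F β t :=
    fun u hu hub t h1 h2 => h.lt_of_consecJumps (hNe u hu hub) (hce u hu hub)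
      (hβ.2.2 _ (Finset.mem_univ _) (hce u hu hub).2.2.1 (hlb u hu hub)) h1 h2
  have hlt' : ∀ u ∈ V, u ≠ σ q → ∀ t, e' u ≤ t → t < q' → F (l' u) t < F β' t :=
    fun u hu hub t h1 h2 => h.lt_of_consecJumps (hNe' u hu hub) (hce' u hu hub)
      (hβ'.2.2 _ (Finset.mem_univ _) (hce' u hu hub).2.2.1 (hlb' u hu hub)) h1 h2
  have hlast : ∀ u ∈ V, u ≠ σ (q - 1) → ∀ t, t < q → σ t = u → t < e u := by
    intro u hu hub t htq ht
    by_contra! hle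
    exact lt_asymm (hlt u hu hub t hle htq) (hiff ((hse u hu hub).trans ht.symm) (hFe u hu hub))
  have hlast' : ∀ u ∈ V, u ≠ σ q → ∀ t, t < q' → σ t = u → t < e' u := by
    intro u hu hub t htq ht
    by_contra! hle
    exact lt_asymm (hlt' u hu hub t hle htq) (hiff ((hse' u hu hub).trans ht.symm) (hFe' u hu hub))
  have hwV : σ q ∈ V := hmem q (by omega)
  have hbV : σ (q - 1) ∈ V := hmem _ (by omega)
  have hu₀b : u₀ ≠ σ (q - 1) := fun heq => hcon (q - 1) (by omega) (by omega) heq.symm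
  have hew : e u₀ < e (σ q) := by
    have h1 := hlast _ hwV hne.symm s hsq hs
    have h2 := hse u₀ hu₀ hu₀b
    have h3 := (hce u₀ hu₀ hu₀b).1
    by_contra! hle
    exact hcon (e u₀ - 1) (by omega) (by omega) h2
  -- the order `v` left first, at time `e v`
  obtain ⟨v, hv, hvmin⟩ := (V.erase (σ (q - 1))).exists_min_image e
    ⟨u₀, Finset.mem_erase.2 ⟨hu₀b, hu₀⟩⟩
  obtain ⟨hvb, hvV⟩ := Finset.mem_erase.1 hv
  have hvw' : e v < e (σ q) := (hvmin u₀ (Finset.mem_erase.2 ⟨hu₀b, hu₀⟩)).trans_lt hew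
  have hvw : v ≠ σ q := by rintro rfl; exact lt_irrefl _ hvw'
  have hmin : ∀ u ∈ V, u ≠ σ (q - 1) → u ≠ v → e v < e u := by
    intro u hu hub huv
    refine lt_of_le_of_ne (hvmin u (Finset.mem_erase.2 ⟨hub, hu⟩)) fun heq => huv ?_
    rw [← hse u hu hub, ← hse v hvV hvb, heq]
  have hee' : ∀ u ∈ V, u ≠ σ (q - 1) → u ≠ σ q → e' u = e u := by
    intro u hu hub huw
    have h1 := hlast' u hu huw (e u - 1) (by have := (hce u hu hub).1; omega) (hse u hu hub)
    have h2 := hNe' u hu huw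
    have h3 := (hce' u hu huw).1
    have h4 : e' u - 1 < q := by
      by_contra! hle
      exact huw ((hse' u hu huw).symm.trans (hconst _ hle (by omega)))
    have h5 := hlast u hu hub _ h4 (hse' u hu huw)
    omega
  have he'b : e' (σ (q - 1)) = q := by
    have h1 := hlast' _ hbV hne (q - 1) (by omega) rfl
    have h2 := hNe' _ hbV hne
    have h3 := (hce' _ hbV hne).1
    have h4 : e' (σ (q - 1)) - 1 < q := by
      by_contra! hle
      exact hne ((hse' _ hbV hne).symm.trans (hconst _ hle (by omega)))
    omega
  have he'v : e' v = e v := hee' v hvV hvb hvw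
  set δ := l v with hδ
  set g := l (σ q) with hg
  have hcδ := hce v hvV hvb
  have hcg := hce _ hwV hne.symm
  have hNv := hNe v hvV hvb
  have hp : σ (e (σ q) - 1) = σ q := hse _ hwV hne.symm
  have hpq : e (σ q) - 1 < q := by have := hcg.1; omega
  have hδβp := hlt v hvV hvb (e (σ q) - 1) (by omega) hpq
  have hδβ : F δ (q - 1) < F β (q - 1) := hlt v hvV hvb (q - 1) (by have := hcδ.1; omega) (by omega)
  obtain ⟨x, hNx, hx⟩ := h.prev hq hβ.2.1
  have hxv : x < e v := h.prev_lt_prev β δ x (e v) q (by omega) (by omega) hx hcδ hδβ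
    (hiff hp hδβp)
  have hβgp := hFe _ hwV hne.symm
  have hgδ : g ≠ δ := by
    intro heq
    rw [← hg, heq] at hcg
    exact hvw'.ne (hcδ.left_unique hcg)
  have hgδb : F g (q - 1) < F δ (q - 1) := by
    refine lt_of_le_of_ne (not_lt.1 fun hlt => ?_) (h.ne _ (by omega) _ _ hgδ)
    have := h.prev_lt_prev g δ (e (σ q)) (e v) q (by omega) (by omega) hcg hcδ hlt
      (hiff hp (hδβp.trans hβgp))
    omega
  -- the next order is `v`
  have hq'v : σ q' = v := by
    by_contra hq'v
    have hw'V : σ q' ∈ V := hmem _ (by omega)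
    have hw'w : σ q' ≠ σ q := by rw [← hwq']; exact hne'.symm
    have he'w' : e v < e' (σ q') := by
      by_cases hw'b : σ q' = σ (q - 1)
      · rw [hw'b, he'b]; exact hcδ.1
      · rw [hee' _ hw'V hw'b hw'w]; exact hmin _ hw'V hw'b hq'v
    have hcδ' := hce' v hvV hvw
    have hcw' := hce' _ hw'V hw'w
    have h1 := hlt' v hvV hvw (e' (σ q') - 1) (by omega) (by have := hcw'.1; omega)
    have h2 := hlt' v hvV hvw (q' - 1) (by have := hcδ'.1; omega) (by omega)
    obtain ⟨x', hNx', hx'⟩ := h.prev (hq.trans hqq') hβ'.2.1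
    have h3 : x' < e' v := h.prev_lt_prev β' (l' v) x' (e' v) q' (by omega) (by omega) hx' hcδ' h2
      (hiff (hse' _ hw'V hw'w) h1)
    have h4 := hFe' _ hbV hne
    rw [he'b] at h4
    have h5 := hlt' _ hbV hne (q' - 1) (by rw [he'b]; omega) (by omega)
    have h6 := hiff (hwq'.trans hp.symm) h5
    refine lt_asymm h4 (lt_of_no_jump (h.anti _) (h.anti _) (a := e (σ q) - 1) (by omega) (by omega)
      h6 fun z hz1 hz2 => hx'.2.2.2 z (by omega) (by omega))
  have hve : σ (e v - 1) = σ q' := by rw [hse v hvV hvb, hq'v]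
  have hδβw : F δ (q' - 1) < F β (q' - 1) := hiff (hp.trans hwq'.symm) hδβp
  have hβδv : F β q' < F δ q' := hiff hve (hFe v hvV hvb)
  have hβq' : Jumps (F β) q' := h.jumps_of_swap (by omega) hδβw hβδv
  set r := l' v with hr
  have hcr := hce' v hvV hvw
  rw [he'v] at hcr
  have hrq : ¬ Jumps (F r) q := hcr.2.2.2 q hcδ.1 hqq'
  have hββ' : β ≠ β' := by
    rintro rfl
    have hcζ := hce' _ hbV hne
    have h4 := hFe' _ hbV hne
    rw [he'b] at hcζ h4
    exact lt_asymm h4 (hβ.2.2 _ (Finset.mem_univ _) hcζ.2.1 (hlb' _ hbV hne))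
  have hβw : F β (q' - 1) < F β' (q' - 1) := hβ'.2.2 _ (Finset.mem_univ _) hβq' hββ'
  have hprevq : ∀ i, Jumps (F i) q → Jumps (F i) q' → F i (q' - 1) < F β' (q' - 1) →
      ConsecJumps (F i) q q' := by
    intro i hi hi' hlt
    obtain ⟨z, hqz, hz⟩ := exists_consecJumps hqq' hi hi'
    have h1 := h.lt_before_prev β' i q' z (by omega) hβ'.2.1 hz hlt
    have h2 := hz.1
    obtain rfl : z = q := by
      by_contra hzq
      exact lt_asymm h1 (hiff (hwq'.trans (hconst (z - 1) (by omega) (by omega)).symm) hlt)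
    exact hz
  have hδq' : ¬ Jumps (F δ) q' := fun hj =>
    h.prev_ne δ β q q' (by omega) (hlb v hvV hvb) (hprevq δ hcδ.2.2.1 hj (hδβw.trans hβw))
      (hprevq β hβ.2.1 hβq' hβw)
  let Q : ι → Prop := fun i => ∀ z, e v < z → z < q → ¬ Jumps (F i) z
  have hQβ : Q β := fun z h1 h2 => hx.2.2.2 z (by omega) h2
  have hQδ : Q δ := fun z h1 h2 => hcδ.2.2.2 z h1 h2
  have hQr : Q r := fun z h1 h2 => hcr.2.2.2 z h1 (by omega)
  have hQeq : ∀ i, Q i → ∀ t, e v ≤ t → t < q → F i t = F i (q - 1) := fun i hi t h1 h2 =>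
    (eq_of_no_jump (h.anti i) (by omega) (by omega : t ≤ q - 1)
      fun z hz1 hz2 => hi z (by omega) (by omega)).symm
  have hrev : ∀ i j, Q i → Q j → F i (q - 1) < F j (q - 1) → F j q' < F i q' := by
    intro i j hi hj hij
    obtain ⟨t, ht, hji⟩ := h.exists_lt j i (by rintro rfl; exact lt_irrefl _ hij) N
    by_cases htv : σ t = v
    · exact hiff (htv.trans hq'v.symm) hji
    exfalso
    obtain ⟨s, hs1, hs2, hs3⟩ : ∃ s, e v ≤ s ∧ s < q ∧ σ s = σ t := by
      by_cases htb : σ t = σ (q - 1)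
      · exact ⟨q - 1, by have := hcδ.1; omega, by omega, htb.symm⟩
      · have h1 := hmin _ (hmem t ht) htb htv
        have h2 := (hce _ (hmem t ht) htb).1
        exact ⟨e (σ t) - 1, by omega, by omega, hse _ (hmem t ht) htb⟩
    have h3 := hiff hs3.symm hji
    rw [hQeq i hi s hs1 hs2, hQeq j hj s hs1 hs2] at h3
    exact lt_asymm h3 hij
  have hQw : ∀ i j, Q i → Q j → F i (q - 1) < F j (q - 1) → F i q < F j q := by
    intro i j hi hj hij
    refine hiff hp ?_
    rwa [hQeq i hi _ (by omega) hpq, hQeq j hj _ (by omega) hpq]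
  have hrδ : r ≠ δ := by intro heq; exact hrq (heq ▸ hcδ.2.2.1)
  have hrβ : r ≠ β := by intro heq; exact hrq (heq ▸ hβ.2.1)
  have hδr : F δ (q - 1) < F r (q - 1) := by
    refine lt_of_le_of_ne (not_lt.1 fun hlt => hδq' ?_) (h.ne _ (by omega) _ _ hrδ.symm)
    exact h.jumps_of_swap (by omega) (hiff hwq'.symm (hQw _ _ hQr hQδ hlt))
      (hrev _ _ hQr hQδ hlt)
  have hrβ' : F r (q - 1) < F β (q - 1) := by
    refine lt_of_le_of_ne (not_lt.1 fun hlt => ?_) (h.ne _ (by omega) _ _ hrβ)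
    refine hx.2.2.2 (e v) hxv hcδ.1 (h.jumps_of_swap hNv
      (hiff hve.symm (hrev _ _ hQβ hQr hlt)) ?_)
    rwa [hQeq _ hQβ _ le_rfl hcδ.1, hQeq _ hQr _ le_rfl hcδ.1]
  exact hrq (h.jumps_of_swap (by omega) (hgδb.trans hδr)
    ((hQw _ _ hQr hQβ hrβ').trans (hiff hp hβgp)))

/-- If the number of functions is maximal, then the sequence of orders at the times of change is
periodic and visits every order once in a period. -/
theorem periodic_orderState (h : Settled F T N M) {c : ℕ}
    (hc : (recurrentStates F Finset.univ).card = c) (hι : c * (c + 1) ≤ 2 * Fintype.card ι)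
    (hι1 : 1 < Fintype.card ι) {u : ℕ → ℕ} (hM : M < u 0) (hu : StrictMono u)
    (hconst : ∀ i s, u i ≤ s → s < u (i + 1) →
      orderState F Finset.univ s = orderState F Finset.univ (u i))
    (hne : ∀ i, orderState F Finset.univ (u (i + 1)) ≠ orderState F Finset.univ (u i)) :
    (∀ i, orderState F Finset.univ (u (i + c)) = orderState F Finset.univ (u i)) ∧
      ∀ i d, 0 < d → d < c →
        orderState F Finset.univ (u (i + d)) ≠ orderState F Finset.univ (u i) := by
  classical
  have hNM := h.threshold_le (Fintype.card_pos_iff.1 (by omega : 0 < Fintype.card ι)).some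
  set σ := orderState F Finset.univ with hσ
  have hu0 : ∀ i, M < u i := fun i => hM.trans_le (hu.monotone (Nat.zero_le i))
  have hmem : ∀ i, σ (u i) ∈ recurrentStates F Finset.univ := fun i =>
    h.mem _ _ (by have := hu0 i; omega)
  have hdist : ∀ i d, 0 < d → d < c → σ (u (i + d)) ≠ σ (u i) := by
    intro i d hd hdc heq
    obtain ⟨d, rfl⟩ : ∃ m, d = m + 1 := ⟨d - 1, by omega⟩
    have hlt := hu (show i + d < i + d + 1 by omega)
    have hlt' := hu (show i < i + 1 by omega)
    have hle := hu.monotone (show i + 1 ≤ i + d + 1 by omega)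
    have hvisit := h.exists_visit hc hι hι1 (hu0 (i + d + 1)) (s := u (i + 1) - 1)
      (fun hc' => hne (i + d)
        (hc'.symm.trans (hconst (i + d) (u (i + d + 1) - 1) (by omega) (by omega))))
      (by omega) ((hconst i (u (i + 1) - 1) (by omega) (by omega)).trans heq.symm)
    have hsub : recurrentStates F Finset.univ ⊆
        (Finset.range (d + 1)).image fun j => σ (u (i + j)) := by
      intro v hv
      obtain ⟨t, ht1, ht2, rfl⟩ := hvisit v hv
      have hfind : ∀ m, t < u (i + m + 1) → ∃ j ≤ m, σ t = σ (u (i + j)) := by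
        intro m
        induction m with
        | zero => exact fun h1 => ⟨0, le_rfl, hconst i t (by omega) h1⟩
        | succ m ih =>
          intro h1
          by_cases h2 : t < u (i + m + 1)
          · obtain ⟨j, hj, hj'⟩ := ih h2
            exact ⟨j, by omega, hj'⟩
          · exact ⟨m + 1, le_rfl, hconst _ t (not_lt.1 h2) h1⟩
      obtain ⟨j, hj, hj'⟩ := hfind d ht2
      exact Finset.mem_image.2 ⟨j, Finset.mem_range.2 (by omega), hj'.symm⟩
    have := (Finset.card_le_card hsub).trans Finset.card_image_le
    rw [hc, Finset.card_range] at this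
    omega
  refine ⟨fun i => ?_, hdist⟩
  have hinj : Set.InjOn (fun j => σ (u (i + 1 + j))) (Finset.range c : Finset ℕ) := by
    intro a ha b hb heq
    simp only [Finset.coe_range, Set.mem_Iio] at ha hb
    rcases lt_trichotomy a b with hab | rfl | hab
    · refine absurd heq.symm ?_
      have := hdist (i + 1 + a) (b - a) (by omega) (by omega)
      rwa [show i + 1 + a + (b - a) = i + 1 + b by omega] at this
    · rfl
    · refine absurd heq ?_
      have := hdist (i + 1 + b) (a - b) (by omega) (by omega)
      rwa [show i + 1 + b + (a - b) = i + 1 + a by omega] at this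
  obtain ⟨j, hj, hj'⟩ := Finset.surjOn_of_injOn_of_card_le _ (fun j _ => hmem (i + 1 + j)) hinj
    (by rw [hc, Finset.card_range]) (hmem i)
  simp only [Finset.coe_range, Set.mem_Iio] at hj hj'
  have hjc : j + 1 = c := by
    by_contra hne
    refine hdist i (j + 1) (by omega) (by omega) ?_
    rwa [show i + (j + 1) = i + 1 + j by omega]
  rw [← hj', ← hjc, show i + (j + 1) = i + 1 + j by omega]

end Settled

end Combinatorics

section Approximation

theorem distToInt_nonneg (x : ℝ) : 0 ≤ distToInt x := abs_nonneg _

theorem distToInt_add_intCast (x : ℝ) (m : ℤ) : distToInt (x + m) = distToInt x := by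
  rw [distToInt, distToInt, round_add_intCast]
  congr 1
  push_cast
  ring

theorem distToInt_neg (x : ℝ) : distToInt (-x) = distToInt x := by
  unfold distToInt
  rw [← UnitAddCircle.norm_eq, ← UnitAddCircle.norm_eq, AddCircle.coe_neg, norm_neg]

theorem distToInt_le_abs (x : ℝ) (m : ℤ) : distToInt x ≤ |x - m| := round_le x m

/-- The irrationality measure function at natural times. -/
noncomputable def psiSeq (α : ℝ) (t : ℕ) : ℝ := psi α t

theorem psi_eq_psiSeq (α t : ℝ) : psi α t = psiSeq α ⌊t⌋₊ := by
  unfold psiSeq psi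
  congr 2
  ext q
  simp only [Set.mem_ofPred_eq]
  refine and_congr_right fun hq => ?_
  lift q to ℕ using by omega
  simp only [Int.cast_natCast, Nat.cast_le]
  exact (Nat.le_floor_iff' (by omega)).symm

theorem finite_psi_set (t : ℝ) : {q : ℤ | 1 ≤ q ∧ (q : ℝ) ≤ t}.Finite :=
  (Set.finite_Icc 1 ⌊t⌋).subset fun _ hq => ⟨hq.1, Int.le_floor.2 hq.2⟩

theorem psiSeq_le (α : ℝ) {m t : ℕ} (hm : 1 ≤ m) (hmt : m ≤ t) :
    psiSeq α t ≤ distToInt (m * α) :=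
  csInf_le ((finite_psi_set t).image _).bddBelow
    ⟨m, ⟨by exact_mod_cast hm, by exact_mod_cast hmt⟩, by simp⟩

theorem exists_psiSeq_eq (α : ℝ) {t : ℕ} (ht : 1 ≤ t) :
    ∃ m : ℕ, 1 ≤ m ∧ m ≤ t ∧ psiSeq α t = distToInt (m * α) := by
  have hne : {q : ℤ | 1 ≤ q ∧ (q : ℝ) ≤ (t : ℝ)}.Nonempty := ⟨1, le_rfl, by exact_mod_cast ht⟩
  obtain ⟨q, ⟨hq1, hq2⟩, hq⟩ := (hne.image fun q : ℤ => distToInt ((q : ℝ) * α)).csInf_mem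
    ((finite_psi_set t).image _)
  lift q to ℕ using by omega
  exact ⟨q, by omega, by exact_mod_cast hq2, by simpa [psiSeq, psi] using hq.symm⟩

theorem psiSeq_pos {α : ℝ} (hα : Irrational α) {t : ℕ} (ht : 1 ≤ t) : 0 < psiSeq α t := by
  obtain ⟨m, hm, -, h⟩ := exists_psiSeq_eq α ht
  rw [h]
  refine (distToInt_nonneg _).lt_of_ne' fun h0 => ?_
  have h1 := (hα.natCast_mul (m := m) (by omega)).ne_int (round (m * α))
  exact h1 (sub_eq_zero.1 (abs_eq_zero.1 h0))

theorem antitoneOn_psiSeq (α : ℝ) : AntitoneOn (psiSeq α) (Set.Ici 1) := by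
  intro s hs t ht hst
  obtain ⟨m, hm, hms, h⟩ := exists_psiSeq_eq α (Set.mem_Ici.1 hs)
  rw [h]
  exact psiSeq_le α hm (hms.trans hst)

theorem mul_psiSeq_le_one (α : ℝ) {q : ℕ} (hq : 2 ≤ q) : q * psiSeq α (q - 1) ≤ 1 := by
  obtain ⟨j, k, hk, hkn, h⟩ := Real.exists_int_int_abs_mul_sub_le α (n := q - 1) (by omega)
  lift k to ℕ using by omega
  have h1 := psiSeq_le α (m := k) (t := q - 1) (by omega) (by omega)
  have h2 := h1.trans (distToInt_le_abs _ j)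
  have h3 : psiSeq α (q - 1) ≤ 1 / (((q - 1 : ℕ) : ℝ) + 1) := h2.trans h
  rw [Nat.cast_sub (by omega), Nat.cast_one, sub_add_cancel, le_div_iff₀ (by positivity)] at h3
  linarith

theorem Jumps.two_le {α : ℝ} {q : ℕ} (h : Jumps (psiSeq α) q) : 2 ≤ q := by
  by_contra! hq
  interval_cases q
  · exact lt_irrefl _ h
  · have h0 : psiSeq α 0 = 0 := by
      have : {q : ℤ | 1 ≤ q ∧ (q : ℝ) ≤ 0} = ∅ := by
        ext q
        simp only [Set.mem_ofPred_eq, Set.mem_empty_iff_false, iff_false, not_and, not_le]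
        exact fun hq => by exact_mod_cast hq
      rw [psiSeq, psi, Nat.cast_zero, this, Set.image_empty, Real.sInf_empty]
    obtain ⟨m, -, -, h1⟩ := exists_psiSeq_eq α le_rfl
    have h2 : psiSeq α 1 < psiSeq α 0 := h
    rw [h0, h1] at h2
    exact absurd h2 (not_lt.2 (distToInt_nonneg _))

theorem Jumps.psiSeq_eq {α : ℝ} {q : ℕ} (h : Jumps (psiSeq α) q) :
    psiSeq α q = distToInt (q * α) := by
  have hq := h.two_le
  obtain ⟨m, hm, hmq, h1⟩ := exists_psiSeq_eq α (t := q) (by omega)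
  by_cases hmq' : m = q
  · rw [h1, hmq']
  · have h2 := psiSeq_le α (t := q - 1) hm (by omega)
    rw [← h1] at h2
    exact absurd h (not_lt.2 h2)

theorem exists_jumps_psiSeq {α : ℝ} (hα : Irrational α) (N : ℕ) :
    ∃ q, N < q ∧ Jumps (psiSeq α) q := by
  by_contra! hc
  have hpos := psiSeq_pos hα (le_max_right N 1)
  obtain ⟨n, hn⟩ := exists_nat_gt (1 / psiSeq α (max N 1))
  rw [div_lt_iff₀ hpos] at hn
  have h1 := eq_of_no_jump (antitoneOn_psiSeq α) (le_max_right N 1)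
    (show max N 1 ≤ n + max N 1 by omega) fun z hz _ => hc z (by omega)
  have h2 := mul_psiSeq_le_one α (q := n + max N 1 + 1) (by omega)
  rw [Nat.add_sub_cancel, h1] at h2
  push_cast at h2
  have h3 : (0 : ℝ) ≤ max (N : ℝ) 1 := by positivity
  nlinarith

/-- Consecutive drop times are denominators of neighbouring best approximations. -/
theorem ConsecJumps.exists_approx {α : ℝ} (hα : Irrational α) {x x' : ℕ}
    (h : ConsecJumps (psiSeq α) x x') :
    ∃ X X' s : ℤ, (s = 1 ∨ s = -1) ∧ x * α - X = s * psiSeq α x ∧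
      x' * α - X' = -s * psiSeq α x' ∧ x * X' - x' * X = s := by
  have hx := h.2.1.two_le
  have hlt := h.1
  have hA : psiSeq α (x' - 1) = psiSeq α x :=
    h.eq_of_mem (antitoneOn_psiSeq α) (by omega) (by omega) (by omega)
  have h1 := mul_psiSeq_le_one α (q := x') (by omega)
  have hA' : psiSeq α x' < psiSeq α x := hA ▸ h.2.2.1
  have hpos := psiSeq_pos hα (t := x') (by omega)
  rw [hA] at h1
  have hd := h.2.1.psiSeq_eq
  have hd' := h.2.2.1.psiSeq_eq
  set A := psiSeq α x
  set A' := psiSeq α x'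
  unfold distToInt at hd hd'
  set X := round (x * α)
  set X' := round (x' * α)
  have hx0 : (2 : ℝ) ≤ x := by exact_mod_cast hx
  have hlt' : (x : ℝ) < x' := by exact_mod_cast hlt
  have hxA : x * A' < 1 := by nlinarith
  have hxA0 : 0 < x * A' := by positivity
  have hDR : ((x * X' - x' * X : ℤ) : ℝ) = x' * (x * α - X) - x * (x' * α - X') := by
    push_cast; ring
  have hbound : ∀ s t : ℝ, x * α - X = s * A → x' * α - X' = t * A' →
      ((x * X' - x' * X : ℤ) : ℝ) = s * (x' * A) - t * (x * A') := by
    intro s t h2 h3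
    rw [hDR, h2, h3]; ring
  have hxxA : x * A' < x' * A := by nlinarith
  rcases abs_choice (x * α - X) with h2 | h2 <;> rcases abs_choice (x' * α - X') with h3 | h3
  · have h4 := hbound 1 1 (by linarith) (by linarith)
    have h5 : 0 < ((x * X' - x' * X : ℤ) : ℝ) := by rw [h4]; linarith
    have h6 : ((x * X' - x' * X : ℤ) : ℝ) < 1 := by rw [h4]; linarith
    norm_cast at h5 h6
    omega
  · have h4 := hbound 1 (-1) (by linarith) (by linarith)
    have h5 : 0 < ((x * X' - x' * X : ℤ) : ℝ) := by rw [h4]; linarith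
    have h6 : ((x * X' - x' * X : ℤ) : ℝ) < 2 := by rw [h4]; linarith
    norm_cast at h5 h6
    exact ⟨X, X', 1, Or.inl rfl, by push_cast; linarith, by push_cast; linarith, by omega⟩
  · have h4 := hbound (-1) 1 (by linarith) (by linarith)
    have h5 : ((x * X' - x' * X : ℤ) : ℝ) < 0 := by rw [h4]; linarith
    have h6 : -2 < ((x * X' - x' * X : ℤ) : ℝ) := by rw [h4]; linarith
    norm_cast at h5 h6
    exact ⟨X, X', -1, Or.inr rfl, by push_cast; linarith, by push_cast; linarith, by omega⟩
  · have h4 := hbound (-1) (-1) (by linarith) (by linarith)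
    have h5 : ((x * X' - x' * X : ℤ) : ℝ) < 0 := by rw [h4]; linarith
    have h6 : -1 < ((x * X' - x' * X : ℤ) : ℝ) := by rw [h4]; linarith
    norm_cast at h5 h6
    omega

theorem ConsecJumps.psiSeq_pred_eq {α : ℝ} {x x' : ℕ} (h : ConsecJumps (psiSeq α) x x') :
    psiSeq α (x' - 1) = psiSeq α x := by
  have hx := h.2.1.two_le
  have hlt := h.1
  exact h.eq_of_mem (antitoneOn_psiSeq α) (by omega) (by omega) (by omega)

theorem ConsecJumps.psiSeq_lt {α : ℝ} {x x' : ℕ} (h : ConsecJumps (psiSeq α) x x') :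
    psiSeq α x' < psiSeq α x := h.psiSeq_pred_eq ▸ h.2.2.1

theorem ConsecJumps.mul_add_mul_eq_one {α : ℝ} (hα : Irrational α) {x x' : ℕ}
    (h : ConsecJumps (psiSeq α) x x') : x' * psiSeq α x + x * psiSeq α x' = 1 := by
  obtain ⟨X, X', s, hs, h1, h2, h3⟩ := h.exists_approx hα
  have h4 : (x * X' - x' * X : ℝ) = s := by exact_mod_cast h3
  have hss : (s : ℝ) * s = 1 := by rcases hs with rfl | rfl <;> norm_num
  linear_combination (-s : ℝ) * x' * h1 + (s : ℝ) * x * h2 + (s : ℝ) * h4 +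
    (1 - x * psiSeq α x' - x' * psiSeq α x) * hss

/-- The recurrence of best approximations. -/
theorem ConsecJumps.exists_recurrence {β : ℝ} (hβ : Irrational β) {p y q : ℕ}
    (h : ConsecJumps (psiSeq β) p y) (h' : ConsecJumps (psiSeq β) y q) :
    ∃ i : ℕ, 1 ≤ i ∧ q = i * y + p ∧ psiSeq β p = i * psiSeq β y + psiSeq β q := by
  obtain ⟨P, Y, s, hs, h1, h2, h3⟩ := h.exists_approx hβ
  obtain ⟨Y', Q, r, hr, h4, h5, h6⟩ := h'.exists_approx hβ
  have hy := h'.2.1.two_le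
  have hlt := h.1
  have hlt' := h'.1
  have hsum := h'.mul_add_mul_eq_one hβ
  have hpos := psiSeq_pos hβ (t := y) (by omega)
  have hposq := psiSeq_pos hβ (t := q) (by omega)
  set B := psiSeq β y
  have hq3 : (3 : ℝ) ≤ q := by exact_mod_cast (by omega : 3 ≤ q)
  have hB : B < 1 / 2 := by nlinarith [mul_nonneg (Nat.cast_nonneg (α := ℝ) y) hposq.le]
  have hYY : ((Y' - Y : ℤ) : ℝ) = -(r + s) * B := by
    push_cast
    linear_combination h2 - h4
  have hrs : r = -s ∧ Y' = Y := by
    rcases hs with rfl | rfl <;> rcases hr with rfl | rfl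
    · have h7 : ((Y' - Y : ℤ) : ℝ) < 0 := by rw [hYY]; push_cast; linarith
      have h8 : -1 < ((Y' - Y : ℤ) : ℝ) := by rw [hYY]; push_cast; linarith
      norm_cast at h7 h8
      omega
    · have h7 : ((Y' - Y : ℤ) : ℝ) = 0 := by rw [hYY]; push_cast; ring
      norm_cast at h7
      omega
    · have h7 : ((Y' - Y : ℤ) : ℝ) = 0 := by rw [hYY]; push_cast; ring
      norm_cast at h7
      omega
    · have h7 : 0 < ((Y' - Y : ℤ) : ℝ) := by rw [hYY]; push_cast; linarith
      have h8 : ((Y' - Y : ℤ) : ℝ) < 1 := by rw [hYY]; push_cast; linarith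
      norm_cast at h7 h8
      omega
  obtain ⟨rfl, rfl⟩ := hrs
  have hcop : IsCoprime (y : ℤ) Y' := by
    rcases hs with rfl | rfl
    · exact ⟨-P, p, by linarith⟩
    · exact ⟨P, -p, by linarith⟩
  have hdvd : (y : ℤ) ∣ (q - p) := by
    refine hcop.dvd_of_dvd_mul_right ⟨Q - P, ?_⟩
    linarith
  obtain ⟨i, hi⟩ := hdvd
  have hi0 : 0 < i := by
    by_contra! hi0
    have : (y : ℤ) * i ≤ 0 := mul_nonpos_of_nonneg_of_nonpos (by omega) hi0
    omega
  lift i to ℕ using hi0.le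
  have hQ : Q = P + i * Y' := by
    have : (y : ℤ) * (Q - P) = y * (i * Y') := by linear_combination h6 + h3 + hi * Y'
    have := mul_left_cancel₀ (by omega : (y : ℤ) ≠ 0) this
    omega
  refine ⟨i, by omega, by zify; linarith, ?_⟩
  have hqR : (q : ℝ) - p = y * i := by exact_mod_cast hi
  have hQR : (Q : ℝ) = P + i * Y' := by exact_mod_cast hQ
  have hs' : (s : ℝ) * s = 1 := by rcases hs with rfl | rfl <;> norm_num
  push_cast at h4 h5
  linear_combination (-s : ℝ) * h1 + (s : ℝ) * h5 - i * s * h2 + (-s : ℝ) * β * hqR +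
    (s : ℝ) * hQR + (psiSeq β q + i * B - psiSeq β p) * hs'

theorem ConsecJumps.psiSeq_lt_of_no_jump {α β : ℝ} (hβ : Irrational β) {p y q : ℕ}
    (h : ConsecJumps (psiSeq β) p y) (h' : ConsecJumps (psiSeq β) y q)
    (hno : ∀ z, y ≤ z → z < q → ¬ Jumps (psiSeq α) z) : psiSeq α (y - 1) < psiSeq β (y - 1) := by
  have hp := h.2.1.two_le
  have hlt := h.1
  have hlt' := h'.1
  obtain ⟨i, hi, hq, -⟩ := h.exists_recurrence hβ h'
  have hsum := h.mul_add_mul_eq_one hβ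
  have hBy := h.psiSeq_lt
  have h1 := mul_psiSeq_le_one α (q := q) (by omega)
  rw [eq_of_no_jump (antitoneOn_psiSeq α) (by omega) (show y - 1 ≤ q - 1 by omega)
    fun z h1 h2 => hno z (by omega) (by omega)] at h1
  rw [h.psiSeq_pred_eq]
  have hyp : y + p ≤ q := by
    rw [hq]; exact Nat.add_le_add_right (Nat.le_mul_of_pos_left y hi) p
  have hqR : (y : ℝ) + p ≤ q := by exact_mod_cast hyp
  have hp0 : (0 : ℝ) < p := by exact_mod_cast (by omega : 0 < p)
  have hy0 : (0 : ℝ) < y := by exact_mod_cast (by omega : 0 < y)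
  have hBpos := psiSeq_pos hβ (t := p) (by omega)
  by_contra! hle
  have h2 : (y + p) * psiSeq β p ≤ q * psiSeq α (y - 1) :=
    mul_le_mul hqR hle hBpos.le (by positivity)
  nlinarith

/-- Later drop times are nonnegative combinations of two consecutive ones. -/
theorem ConsecJumps.exists_combination {α : ℝ} (hα : Irrational α) {x x' q : ℕ}
    (h : ConsecJumps (psiSeq α) x x') (hq : Jumps (psiSeq α) q) (hxq : x' < q) :
    ∃ a b : ℕ, 1 ≤ a ∧ 1 ≤ b ∧ q = a * x' + b * x ∧
      psiSeq α q = |a * psiSeq α x' - b * psiSeq α x| := by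
  obtain ⟨X, X', s, hs, h1, h2, h3⟩ := h.exists_approx hα
  have hx := h.2.1.two_le
  have hx' := h.2.2.1.two_le
  have hA := h.psiSeq_lt
  have hpos' := psiSeq_pos hα (t := x') (by omega)
  have hAq : psiSeq α q < psiSeq α x' := by
    have h4 : psiSeq α q < psiSeq α (q - 1) := hq
    have h5 := antitoneOn_psiSeq α (Set.mem_Ici.2 (show 1 ≤ x' by omega))
      (Set.mem_Ici.2 (show 1 ≤ q - 1 by omega)) (show x' ≤ q - 1 by omega)
    linarith
  have hq' := hq.psiSeq_eq
  unfold distToInt at hq'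
  set Q := round (q * α)
  have hss : s * s = 1 := by rcases hs with rfl | rfl <;> norm_num
  obtain ⟨a, ha⟩ : ∃ a : ℤ, a = s * (x * Q - q * X) := ⟨_, rfl⟩
  obtain ⟨b, hb⟩ : ∃ b : ℤ, b = s * (q * X' - x' * Q) := ⟨_, rfl⟩
  have hqab : (q : ℤ) = a * x' + b * x := by
    rw [ha, hb]; linear_combination (-s * q) * h3 - q * hss
  have hQab : Q = a * X' + b * X := by
    rw [ha, hb]; linear_combination (-s * Q) * h3 - Q * hss
  have hres : psiSeq α q = |a * psiSeq α x' - b * psiSeq α x| := by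
    have hqR : (q : ℝ) = a * x' + b * x := by exact_mod_cast hqab
    have hQR : (Q : ℝ) = a * X' + b * X := by exact_mod_cast hQab
    have h4 : q * α - Q = s * (b * psiSeq α x - a * psiSeq α x') := by
      linear_combination α * hqR - hQR + a * h2 + b * h1
    have h5 : |(s : ℝ)| = 1 := by rcases hs with rfl | rfl <;> norm_num
    rw [hq', h4, abs_mul, h5, one_mul, abs_sub_comm]
  set A := psiSeq α x
  set A' := psiSeq α x'
  have hab : 0 < a ∧ 0 < b := by
    rcases le_or_gt a 0 with ha0 | ha0
    · exfalso
      have hb0 : 1 ≤ b := by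
        by_contra! hb0
        have h4 := mul_nonpos_of_nonpos_of_nonneg ha0 (by omega : (0 : ℤ) ≤ x')
        have h5 := mul_nonpos_of_nonpos_of_nonneg (by omega : b ≤ 0) (by omega : (0 : ℤ) ≤ x)
        omega
      have ha0R : (a : ℝ) ≤ 0 := by exact_mod_cast ha0
      have hb0R : (1 : ℝ) ≤ b := by exact_mod_cast hb0
      have h4 := neg_le_abs (a * A' - b * A)
      nlinarith
    · refine ⟨ha0, ?_⟩
      by_contra! hb0
      have ha0R : (1 : ℝ) ≤ a := by exact_mod_cast ha0
      have hb0R : (b : ℝ) ≤ 0 := by exact_mod_cast hb0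
      have h4 := le_abs_self (a * A' - b * A)
      nlinarith
  lift a to ℕ using hab.1.le
  lift b to ℕ using hab.2.le
  exact ⟨a, b, by omega, by omega, by exact_mod_cast hqab, by exact_mod_cast hres⟩

theorem psiSeq_lt_before_prev {α β : ℝ} (hα : Irrational α) (hβ : Irrational β) {z z' y q : ℕ}
    (hz : Jumps (psiSeq α) z) (hzy : z < y) (hz' : Jumps (psiSeq β) z') (hzy' : z' < y)
    (hq : Jumps (psiSeq α) q) (hyq : ConsecJumps (psiSeq β) y q)
    (hlt : psiSeq β (q - 1) < psiSeq α (q - 1)) : psiSeq α (y - 1) < psiSeq β (y - 1) := by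
  classical
  have hz2 := hz.two_le
  have hlt' := hyq.1
  obtain ⟨p, -, hp⟩ := exists_consecJumps hzy' hz' hyq.2.1
  have hp2 := hp.2.1.two_le
  have hpy := hp.1
  have hex : ∃ x', y ≤ x' ∧ Jumps (psiSeq α) x' := ⟨q, hlt'.le, hq⟩
  obtain ⟨hyx', hx'⟩ := Nat.find_spec hex
  have hx'q : Nat.find hex ≤ q := Nat.find_min' hex ⟨hlt'.le, hq⟩
  have hfind : ∀ w, y ≤ w → w < Nat.find hex → ¬ Jumps (psiSeq α) w := fun w h1 h2 h3 =>
    Nat.find_min hex h2 ⟨h1, h3⟩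
  set x' := Nat.find hex
  rcases hx'q.eq_or_lt with heq | hx'q
  · exact hp.psiSeq_lt_of_no_jump hβ hyq fun w h1 h2 => hfind w h1 (by omega)
  obtain ⟨x, hzx, hx⟩ := exists_consecJumps (by omega : z < x') hz hx'
  have hxy : x < y := by
    by_contra! hle
    exact hfind x hle hx.1 hx.2.1
  obtain ⟨u, hxu, hu⟩ := exists_consecJumps hx'q hx' hq
  obtain ⟨j, j', hj, hj', hqj, hAq⟩ := hx.exists_combination hα hq hx'q
  obtain ⟨i, hi, hqi, hBp⟩ := hp.exists_recurrence hβ hyq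
  have hs1 := hx.mul_add_mul_eq_one hα
  have hs2 := hu.mul_add_mul_eq_one hα
  have hs3 := hp.mul_add_mul_eq_one hβ
  have hs4 := hyq.mul_add_mul_eq_one hβ
  rw [hu.psiSeq_pred_eq, hyq.psiSeq_pred_eq] at hlt
  rw [hp.psiSeq_pred_eq]
  have hAx : psiSeq α (y - 1) = psiSeq α x :=
    hx.eq_of_mem (antitoneOn_psiSeq α) (by omega) (by omega) (by omega)
  rw [hAx]
  by_contra! hle
  have hAq0 := psiSeq_pos hα (t := q) (by omega)
  have hBq0 := psiSeq_pos hβ (t := q) (by omega)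
  have hAu0 := psiSeq_pos hα (t := u) (by omega)
  set A := psiSeq α x
  set A' := psiSeq α x'
  set Au := psiSeq α u
  set Aq := psiSeq α q
  set B := psiSeq β p
  set B' := psiSeq β y
  set Bq := psiSeq β q
  have hqjR : (q : ℝ) = j * x' + j' * x := by exact_mod_cast hqj
  have hqiR : (q : ℝ) = i * y + p := by exact_mod_cast hqi
  have hx0 : (0 : ℝ) < x := by exact_mod_cast (by omega : 0 < x)
  have hp0 : (0 : ℝ) < p := by exact_mod_cast (by omega : 0 < p)
  have hy0 : (0 : ℝ) < y := by exact_mod_cast (by omega : 0 < y)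
  have hq0 : (0 : ℝ) < q := by exact_mod_cast (by omega : 0 < q)
  have hyu : (y : ℝ) ≤ u := by exact_mod_cast hyx'.trans hxu
  have hxu : (x : ℝ) ≤ u := by exact_mod_cast (by omega : x ≤ u)
  have hAqBq : Aq < Bq := by
    by_contra! hge
    have h1 : q * B' < q * Au := by gcongr
    have h2 : y * Bq ≤ u * Aq := mul_le_mul hyu hge hBq0.le (by linarith)
    linarith
  have hqB : q * B = i + p * Bq := by
    rw [hqiR]; linear_combination i * hs3 + p * hBp
  have hqA : q * A ≤ j + x * Aq := by
    have h1 := neg_le_abs (j * A' - j' * A)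
    rw [← hAq] at h1
    have h2 : q * A = j - x * (j * A' - j' * A) := by
      rw [hqjR]; linear_combination j * hs1
    have := mul_le_mul_of_nonneg_left h1 hx0.le
    linarith
  have hqAB : q * B ≤ q * A := by gcongr
  have hxAq : x * Aq < 1 := by
    have h1 : x * Aq ≤ u * Aq := by gcongr
    have h2 : 0 < q * Au := by positivity
    linarith
  have hpBq : 0 < p * Bq := by positivity
  have hij : i ≤ j := by
    have : (i : ℝ) < j + 1 := by linarith
    exact Nat.lt_succ_iff.1 (by exact_mod_cast this)
  have hj'x : x ≤ j' * x := Nat.le_mul_of_pos_left x hj'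
  rcases hij.eq_or_lt with rfl | hij
  · have hpx : p < x := by
      have h1 : p * Aq < p * Bq := by gcongr
      have h2 : p * Aq < x * Aq := by linarith
      exact_mod_cast lt_of_mul_lt_mul_right h2 hAq0.le
    have := Nat.mul_le_mul_left i hyx'
    omega
  · have := Nat.mul_le_mul (hij : i + 1 ≤ j) hyx'
    rw [Nat.succ_mul] at this
    omega

theorem psiSeq_prev_lt_prev {α β : ℝ} (hα : Irrational α) (hβ : Irrational β) {x y q : ℕ}
    (hx : ConsecJumps (psiSeq α) x q) (hy : ConsecJumps (psiSeq β) y q)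
    (h : psiSeq β (q - 1) < psiSeq α (q - 1)) (h' : psiSeq β q < psiSeq α q) : x < y := by
  rw [hx.psiSeq_pred_eq, hy.psiSeq_pred_eq] at h
  have h1 := hx.mul_add_mul_eq_one hα
  have h2 := hy.mul_add_mul_eq_one hβ
  have hq := hx.2.2.1.two_le
  have hpos := psiSeq_pos hβ (t := q) (by omega)
  have hq0 : (0 : ℝ) < q := by exact_mod_cast (by omega : 0 < q)
  by_contra! hle
  have h3 : (y : ℝ) * psiSeq β q ≤ x * psiSeq α q :=
    mul_le_mul (by exact_mod_cast hle) h'.le hpos.le (by positivity)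
  have h4 : (q : ℝ) * psiSeq β y < q * psiSeq α x := by gcongr
  linarith

theorem distToInt_le_of_consecJumps {α β : ℝ} (hα : Irrational α) (hβ : Irrational β) {x x' : ℕ}
    (h : ConsecJumps (psiSeq α) x x') (h' : ConsecJumps (psiSeq β) x x') :
    distToInt (α - β) ≤ 1 / x ∨ distToInt (α + β) ≤ 1 / x := by
  obtain ⟨X, X', s, hs, h1, h2, h3⟩ := h.exists_approx hα
  obtain ⟨Y, Y', r, hr, h4, h5, h6⟩ := h'.exists_approx hβ
  have hx := h.2.1.two_le
  have hlt := h.1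
  have hx0 : (0 : ℝ) < x := by exact_mod_cast (by omega : 0 < x)
  have hx'1 : (1 : ℝ) ≤ x' := by exact_mod_cast (by omega : 1 ≤ x')
  have hcop : IsCoprime (x : ℤ) x' := by
    rcases hs with rfl | rfl
    · exact ⟨X', -X, by linarith⟩
    · exact ⟨-X', X, by linarith⟩
  have hle : ∀ {γ : ℝ}, Irrational γ → ConsecJumps (psiSeq γ) x x' →
      0 ≤ psiSeq γ x ∧ psiSeq γ x ≤ 1 := by
    intro γ hγ hc
    have h7 := hc.mul_add_mul_eq_one hγ
    have h8 := psiSeq_pos hγ (t := x) (by omega)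
    have h9 := psiSeq_pos hγ (t := x') (by omega)
    exact ⟨h8.le, by nlinarith [mul_pos hx0 h9]⟩
  obtain ⟨hA0, hA1⟩ := hle hα h
  obtain ⟨hB0, hB1⟩ := hle hβ h'
  have hs1 : |(s : ℝ)| = 1 := by rcases hs with rfl | rfl <;> norm_num
  have key : ∀ (γ : ℝ) (m : ℤ), x * (γ - m) = s * (psiSeq α x - psiSeq β x) →
      distToInt γ ≤ 1 / x := by
    intro γ m hm
    refine (distToInt_le_abs γ m).trans ?_
    rw [le_div_iff₀ hx0, ← abs_of_pos hx0, ← abs_mul, mul_comm, hm, abs_mul, hs1, one_mul]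
    exact abs_sub_le_iff.2 ⟨by linarith, by linarith⟩
  have hrs : r = s ∨ r = -s := by
    rcases hs with rfl | rfl <;> rcases hr with rfl | rfl <;> norm_num
  rcases hrs with rfl | rfl
  · left
    obtain ⟨m, hm⟩ : (x : ℤ) ∣ X - Y :=
      hcop.dvd_of_dvd_mul_left ⟨X' - Y', by linarith⟩
    have hmR : (X : ℝ) - Y = x * m := by exact_mod_cast hm
    exact key _ m (by linear_combination h1 - h4 + hmR)
  · right
    obtain ⟨m, hm⟩ : (x : ℤ) ∣ X + Y :=
      hcop.dvd_of_dvd_mul_left ⟨X' + Y', by linarith⟩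
    have hmR : (X : ℝ) + Y = x * m := by exact_mod_cast hm
    push_cast at h4
    exact key _ m (by linear_combination h1 + h4 + hmR)

/-- No irrationality measure function dominates another one from some time on. -/
theorem exists_psiSeq_le {α β : ℝ} (hα : Irrational α) (hβ : Irrational β) (N : ℕ) :
    ∃ t, N ≤ t ∧ psiSeq α t ≤ psiSeq β t := by
  classical
  by_contra! hc
  obtain ⟨z, hNz, hz⟩ := exists_jumps_psiSeq hα N
  obtain ⟨c₀, hc₀, hj₀⟩ := exists_jumps_psiSeq hβ z
  obtain ⟨c₁, hc₁, hj₁⟩ := exists_jumps_psiSeq hβ c₀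
  obtain ⟨r', hr', hj'⟩ := exists_jumps_psiSeq hβ c₁
  obtain ⟨r, hcr, hr⟩ := exists_consecJumps hr' hj₁ hj'
  obtain ⟨p, hcp, hp⟩ := exists_consecJumps (hc₁.trans_le hcr) hj₀ hr.2.1
  have hpr := hp.1
  have hrr' := hr.1
  have hex : ∃ x', r' ≤ x' ∧ Jumps (psiSeq α) x' :=
    let ⟨x', h1, h2⟩ := exists_jumps_psiSeq hα r'
    ⟨x', h1.le, h2⟩
  obtain ⟨hx'r, hx'⟩ := Nat.find_spec hex
  have hfind : ∀ w, r' ≤ w → w < Nat.find hex → ¬ Jumps (psiSeq α) w := fun w h1 h2 h3 =>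
    Nat.find_min hex h2 ⟨h1, h3⟩
  set x' := Nat.find hex
  obtain ⟨x, hzx, hx⟩ := exists_consecJumps (by omega : z < x') hz hx'
  have hxr' : x < r' := by
    by_contra! hle
    exact hfind x hle hx.1 hx.2.1
  by_cases hjump : ∃ w, (r' < w ∧ w ≤ x') ∧ Jumps (psiSeq β) w
  · obtain ⟨⟨h1, h2⟩, h3⟩ := Nat.find_spec hjump
    have h4 : ConsecJumps (psiSeq β) r' (Nat.find hjump) :=
      ⟨h1, hj', h3, fun w hw1 hw2 hw3 => Nat.find_min hjump hw2 ⟨⟨hw1, by omega⟩, hw3⟩⟩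
    have h5 := hr.psiSeq_lt_of_no_jump hβ (α := α) h4 fun w hw1 hw2 => hfind w hw1 (by omega)
    exact lt_asymm h5 (hc (r' - 1) (by omega))
  · push Not at hjump
    have hB' := eq_of_no_jump (antitoneOn_psiSeq β) (by omega) hx'r
      fun w h1 h2 => hjump w ⟨h1, h2⟩
    have hA := hx.eq_of_mem (t := r' - 1) (antitoneOn_psiSeq α) (by omega) (by omega) (by omega)
    have h1 := hc (r' - 1) (by omega)
    have h2 := hc x' (by omega)
    rw [hA, hr.psiSeq_pred_eq] at h1
    rw [hB'] at h2
    have hs1 := hx.mul_add_mul_eq_one hα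
    have hs2 := hr.mul_add_mul_eq_one hβ
    have hpos := psiSeq_pos hβ (t := r') (by omega)
    have hpos' := psiSeq_pos hβ (t := r) (by omega)
    have hx0 : (0 : ℝ) < x' := by exact_mod_cast (by omega : 0 < x')
    have hxr : x < r := by
      by_contra! hle
      have h3 : (r : ℝ) * psiSeq β r' ≤ x * psiSeq α x' :=
        mul_le_mul (by exact_mod_cast hle) h2.le hpos.le (by positivity)
      have h4 : (r' : ℝ) * psiSeq β r ≤ x' * psiSeq β r :=
        mul_le_mul_of_nonneg_right (by exact_mod_cast hx'r) hpos'.le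
      have h5 : (x' : ℝ) * psiSeq β r < x' * psiSeq α x := by gcongr
      linarith
    have h5 := hp.psiSeq_lt_of_no_jump hβ (α := α) hr
      fun w hw1 hw2 => hx.2.2.2 w (by omega) (by omega)
    exact lt_asymm h5 (hc (r - 1) (by omega))

theorem psi_congr {α β : ℝ} (h : ∀ q : ℤ, distToInt (q * α) = distToInt (q * β)) (t : ℝ) :
    psi α t = psi β t := by
  simp only [psi, h]

theorem PairwiseIndependent.distToInt_pos {n : ℕ} {α : Fin n → ℝ} (h : PairwiseIndependent α)
    {i j : Fin n} (hij : i ≠ j) : 0 < distToInt (α i - α j) ∧ 0 < distToInt (α i + α j) := by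
  obtain ⟨T, -, hT⟩ := h
  have hne := hT T le_rfl i j hij
  constructor <;> refine (distToInt_nonneg _).lt_of_ne' fun h0 => hne (psi_congr (fun q => ?_) T)
  · obtain ⟨m, hm⟩ : ∃ m : ℤ, α i - α j = m := ⟨_, sub_eq_zero.1 (abs_eq_zero.1 h0)⟩
    rw [show q * α i = q * α j + ((q * m : ℤ) : ℝ) by push_cast; linear_combination q * hm,
      distToInt_add_intCast]
  · obtain ⟨m, hm⟩ : ∃ m : ℤ, α i + α j = m := ⟨_, sub_eq_zero.1 (abs_eq_zero.1 h0)⟩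
    rw [show q * α i = -(q * α j) + ((q * m : ℤ) : ℝ) by push_cast; linear_combination q * hm,
      distToInt_add_intCast, distToInt_neg]

theorem PairwiseIndependent.exists_oscillatingFamily {n : ℕ} {α : Fin n → ℝ}
    (h : PairwiseIndependent α) (hα : ∀ i, Irrational (α i)) :
    ∃ T, OscillatingFamily (fun i => psiSeq (α i)) T := by
  obtain ⟨T₀, -, hT₀⟩ := id h
  have hjump : ∀ᶠ T : ℕ in Filter.atTop, ∀ i, ∃ z, z ≤ T ∧ Jumps (psiSeq (α i)) z := by
    refine Filter.eventually_all.2 fun i => ?_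
    obtain ⟨z, -, hz⟩ := exists_jumps_psiSeq (hα i) 0
    filter_upwards [Filter.eventually_ge_atTop z] with T hT using ⟨z, hT, hz⟩
  have hdist : ∀ᶠ T : ℕ in Filter.atTop, ∀ i j, i ≠ j →
      1 / (T : ℝ) < distToInt (α i - α j) ∧ 1 / (T : ℝ) < distToInt (α i + α j) := by
    refine Filter.eventually_all.2 fun i => Filter.eventually_all.2 fun j => ?_
    by_cases hij : i = j
    · exact Filter.Eventually.of_forall fun _ hne => absurd hij hne
    obtain ⟨h1, h2⟩ := h.distToInt_pos hij
    filter_upwards [tendsto_one_div_atTop_nhds_zero_nat.eventually_lt_const h1,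
      tendsto_one_div_atTop_nhds_zero_nat.eventually_lt_const h2] with T h3 h4 _ using ⟨h3, h4⟩
  obtain ⟨T, hT1, hTT₀, hjump, hdist⟩ := ((Filter.eventually_ge_atTop 1).and
    ((Filter.eventually_ge_atTop ⌈T₀⌉₊).and (hjump.and hdist))).exists
  have hne : ∀ t : ℕ, T ≤ t → ∀ i j, i ≠ j → psiSeq (α i) t ≠ psiSeq (α j) t := fun t ht =>
    hT₀ t (Nat.ceil_le.1 (hTT₀.trans ht))
  refine ⟨T, ?_, hne, ?_, ?_, ?_, ?_, ?_⟩
  · exact fun i => (antitoneOn_psiSeq (α i)).mono (Set.Ici_subset_Ici.2 hT1)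
  · exact fun i N => exists_jumps_psiSeq (hα i) N
  · intro i j q y hy hq hc hlt
    obtain ⟨z, hzT, hz⟩ := hjump i
    obtain ⟨z', hzT', hz'⟩ := hjump j
    exact psiSeq_lt_before_prev (hα i) (hα j) hz (by omega) hz' (by omega) hq hc hlt
  · intro i j y q hy hij hc hc'
    obtain ⟨h1, h2⟩ := hdist i j hij
    have h3 : 1 / (y : ℝ) ≤ 1 / T :=
      one_div_le_one_div_of_le (by exact_mod_cast hT1) (by exact_mod_cast hy.le)
    rcases distToInt_le_of_consecJumps (hα i) (hα j) hc hc' with h4 | h4 <;> linarith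
  · exact fun i j x y q _ _ hx hy h1 h2 => psiSeq_prev_lt_prev (hα i) (hα j) hx hy h1 h2
  · intro i j hij N
    obtain ⟨t, ht, hle⟩ := exists_psiSeq_le (hα i) (hα j) (max N T)
    exact ⟨t, le_of_max_le_left ht, lt_of_le_of_ne hle (hne t (le_of_max_le_right ht) i j hij)⟩

end Approximation

section OrderVectors

variable {n : ℕ} {α : Fin n → ℝ}

theorem sameOrder_iff {t t' : ℝ} : SameOrder α t t' ↔
    orderState (fun i => psiSeq (α i)) Finset.univ ⌊t⌋₊ =
      orderState (fun i => psiSeq (α i)) Finset.univ ⌊t'⌋₊ := by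
  simp only [SameOrder, psi_eq_psiSeq _ t, psi_eq_psiSeq _ t']
  constructor
  · intro h
    ext ⟨i, j⟩
    simpa [orderState] using h i j
  · exact fun h i j => lt_iff_of_orderState_eq h (Finset.mem_univ i) (Finset.mem_univ j)

open Classical in
/-- The order relation described by an order vector. -/
noncomputable def orderOfVec (v : Fin n → Fin n) : Finset (Fin n × Fin n) :=
  Finset.univ.filter fun p => ∃ a b, v a = p.1 ∧ v b = p.2 ∧ b < a

theorem IsOrderVec.orderState_eq {t : ℝ} {v : Fin n → Fin n} (h : IsOrderVec α t v) :
    orderState (fun i => psiSeq (α i)) Finset.univ ⌊t⌋₊ = orderOfVec v := by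
  ext ⟨i, j⟩
  obtain ⟨a, rfl⟩ := h.1.2 i
  obtain ⟨b, rfl⟩ := h.1.2 j
  simp only [orderState, orderOfVec, ← psi_eq_psiSeq, Finset.mem_filter, Finset.mem_univ,
    Finset.univ_product_univ, true_and]
  constructor
  · refine fun hlt => ⟨a, b, rfl, rfl, ?_⟩
    rcases lt_trichotomy a b with hab | rfl | hab
    · exact absurd hlt (lt_asymm (h.2 a b hab))
    · exact absurd hlt (lt_irrefl _)
    · exact hab
  · rintro ⟨a', b', ha, hb, hlt⟩
    rw [← ha, ← hb]
    exact h.2 b' a' hlt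

theorem IsOrderVec.of_sameOrder {t t' : ℝ} {v : Fin n → Fin n} (h : IsOrderVec α t v)
    (hs : SameOrder α t t') : IsOrderVec α t' v :=
  ⟨h.1, fun p q hpq => (hs _ _).1 (h.2 p q hpq)⟩

theorem IsOrderVec.unique {t : ℝ} {v v' : Fin n → Fin n} (h : IsOrderVec α t v)
    (h' : IsOrderVec α t v') : v = v' := by
  have key : ∀ {w}, IsOrderVec α t w → StrictMono fun p => -psi (α (w p)) t :=
    fun hw p q hpq => neg_lt_neg (hw.2 p q hpq)
  have hrange : ∀ {w}, IsOrderVec α t w →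
      Set.range (fun p => -psi (α (w p)) t) = Set.range fun i => -psi (α i) t :=
    fun hw => hw.1.2.range_comp fun i => -psi (α i) t
  have heq := ((key h).range_inj (key h')).1 ((hrange h).trans (hrange h').symm)
  funext p
  obtain ⟨q, hq⟩ := h.1.2 (v' p)
  have h1 := congrFun heq p
  rw [← hq] at h1 ⊢
  rw [(key h).injective h1]

theorem exists_isOrderVec {t : ℝ} (h : ∀ i j, i ≠ j → psi (α i) t ≠ psi (α j) t) :
    ∃ v, IsOrderVec α t v := by
  let f : Fin n → ℝ := fun i => -psi (α i) t
  have hf : Function.Injective f := fun i j hij => by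
    by_contra hne
    exact h i j hne (neg_injective hij)
  refine ⟨Tuple.sort f, (Tuple.sort f).bijective, fun p q hpq => ?_⟩
  exact neg_lt_neg_iff.1 ((Tuple.monotone_sort f).strictMono_of_injective
    (hf.comp (Tuple.sort f).injective) hpq)

theorem card_recurrentStates_eq (hind : PairwiseIndependent α) :
    (recurrentStates (fun i => psiSeq (α i)) Finset.univ).card = kAlpha α := by
  classical
  obtain ⟨T, -, hT⟩ := hind
  have hinj : Set.InjOn orderOfVec {v | OccursInfinitely α v} := by
    intro v hv v' hv' heq
    obtain ⟨t, -, ht⟩ := hv 0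
    obtain ⟨t', -, ht'⟩ := hv' 0
    refine IsOrderVec.unique ht (ht'.of_sameOrder (sameOrder_iff.2 ?_))
    rw [ht.orderState_eq, ht'.orderState_eq, heq]
  have himg : orderOfVec '' {v | OccursInfinitely α v} =
      (recurrentStates (fun i => psiSeq (α i)) Finset.univ : Set (Finset (Fin n × Fin n))) := by
    ext w
    simp only [recurrentStates, Set.mem_image, Finset.coe_filter, Finset.mem_univ, true_and]
    constructor
    · rintro ⟨v, hv, rfl⟩ N
      obtain ⟨t, ht, htv⟩ := hv N
      exact ⟨⌊t⌋₊, Nat.le_floor ht.le, htv.orderState_eq⟩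
    · intro hw
      obtain ⟨s, hs, rfl⟩ := hw ⌈T⌉₊
      obtain ⟨v, hv⟩ := exists_isOrderVec (hT s (Nat.ceil_le.1 hs))
      refine ⟨v, fun T' => ?_, by rw [← hv.orderState_eq, Nat.floor_natCast]⟩
      obtain ⟨t, ht, hts⟩ := hw (⌊T'⌋₊ + 1)
      refine ⟨t, Nat.lt_of_floor_lt (by omega), hv.of_sameOrder (sameOrder_iff.2 ?_)⟩
      rw [Nat.floor_natCast, Nat.floor_natCast, hts]
  rw [kAlpha, Nat.card_coe_set_eq, ← hinj.ncard_image, himg, Set.ncard_coe_finset]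

end OrderVectors

/-- **Theorem (Main), item (ii).** The sequence of order vectors at the moments of
permutation changes is periodic with period `k`, and the first `k` values are
pairwise distinct. -/
theorem stmt11 (k : ℕ) (hk : 2 ≤ k) (n : ℕ) (hn : n = k * (k + 1) / 2)
    (α : Fin n → ℝ) (hirr : ∀ i, Irrational (α i)) (hind : PairwiseIndependent α)
    (hka : kAlpha α = k) :
    ∃ T : ℝ, 1 < T ∧ ∀ t0 : ℝ, T ≤ t0 → ∀ ts : ℕ → ℝ, ts 0 = t0 → IsChangeSeq α ts →
      (∀ i : ℕ, i < k → ∀ s : ℕ, SameOrder α (ts i) (ts (i + s * k))) ∧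
      (∀ i j : ℕ, i < k → j < k → i ≠ j → ¬ SameOrder α (ts i) (ts j)) := by
  obtain ⟨T, hT⟩ := hind.exists_oscillatingFamily hirr
  obtain ⟨N, M, h⟩ := hT.exists_settled
  have hcard : 2 * n = k * (k + 1) := by
    rw [hn, Nat.mul_div_cancel' (Nat.even_mul_succ_self k).two_dvd]
  have hn1 : 1 < n := by nlinarith
  refine ⟨M + 2, by linarith [Nat.cast_nonneg (α := ℝ) M], ?_⟩
  rintro _ hM ts rfl hts
  have hmono : StrictMono ts := strictMono_nat_of_lt_succ fun i => (hts i).1.1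
  have hpos : ∀ i, 0 ≤ ts i := fun i => by
    have h1 := hmono.monotone (Nat.zero_le i)
    linarith [Nat.cast_nonneg (α := ℝ) M]
  have hne : ∀ i, orderState (fun i => psiSeq (α i)) Finset.univ ⌊ts (i + 1)⌋₊ ≠
      orderState (fun i => psiSeq (α i)) Finset.univ ⌊ts i⌋₊ := fun i heq =>
    (hts i).1.2 (sameOrder_iff.2 heq.symm)
  obtain ⟨hper, hdist⟩ := h.periodic_orderState ((card_recurrentStates_eq hind).trans hka)
    (by rw [Fintype.card_fin, hcard]) (by rwa [Fintype.card_fin]) (u := fun i => ⌊ts i⌋₊)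
    (Nat.lt_of_succ_le (Nat.le_floor (by push_cast; linarith)))
    (strictMono_nat_of_lt_succ fun i => lt_of_le_of_ne (Nat.floor_mono (hts i).1.1.le)
      fun heq => hne i (by rw [heq]))
    (fun i s h1 h2 => by
      rcases h1.eq_or_lt with rfl | h1
      · rfl
      have h3 : (s : ℝ) < ts (i + 1) := by
        have h4 : ((s + 1 : ℕ) : ℝ) ≤ ts (i + 1) := (Nat.le_floor_iff (hpos _)).1 h2
        push_cast at h4
        linarith
      by_contra hc
      refine absurd ((hts i).2 ⟨Nat.lt_of_floor_lt h1, fun hs => hc ?_⟩) (not_le.2 h3)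
      have := sameOrder_iff.1 hs
      rw [Nat.floor_natCast] at this
      exact this.symm)
    hne
  refine ⟨fun i _ s => sameOrder_iff.2 ?_, fun i j hi hj hij hs => ?_⟩
  · induction s with
    | zero => simp
    | succ s ih => rw [ih, ← hper, show i + s * k + k = i + (s + 1) * k by ring]
  · have heq := sameOrder_iff.1 hs
    rcases hij.lt_or_gt with hlt | hlt
    · have := hdist i (j - i) (by omega) (by omega)
      rw [Nat.add_sub_cancel' hlt.le] at this
      exact this heq.symm
    · have := hdist j (i - j) (by omega) (by omega)
      rw [Nat.add_sub_cancel' hlt.le] at this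
      exact this heq
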